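/- Given real intervals [t₀,t₁] and [c,d] with t₀ < t₁ and c < d, and given k₀ ∈ ℕ and δ₀ > 0, there exist a continuous map γ : [t₀,t₁] → 𝕋 × [c,d], a map t ↦ F_t ∈ C^∞(𝕋) continuous into the C^∞ topology, and a continuous function ψ : 𝕋 × [c,d] → ℝ, satisfying: (i) F_{t₀} ≡ c, F_{t₁} ≡ d; (ii) if t ≤ s then F_t ≤ F_s pointwise; (iii) writing γ(t) = (x(t), y(t)), y(t) = F_t(x(t)); (iv) F_t′(x) = ψ(x, F_t(x)) for all t, x; (v) for each t ∈ (t₀,t₁], γ([t₀,t]) equals the closure of the interior (in 𝕋 × ℝ) of {(x,y) : x ∈ 𝕋, c ≤ y ≤ F_t(x)}; (vi) γ(t₀) = (0, c) and γ(t₁) = (0, d); (vii) for every t ∈ [t₀,t₁], ‖F_t − c_t‖_{k₀} < δ₀, where c_t is the constant (c(t₁ − t) + d(t − t₀))/(t₁ − t₀). -/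

import Mathlib

open Set

/-- The circle `𝕋 = ℝ/2πℤ`. -/
abbrev RealTorus : Type := AddCircle (2 * Real.pi)

open scoped ContDiff Topology
open Filter

namespace PeanoWalk

/-- All derivatives of `f` of order at most `k` are bounded by `C`. -/
def DerivBound (k : ℕ) (f : ℝ → ℝ) (C : ℝ) : Prop :=
  ∀ i ≤ k, ∀ x, |iteratedDeriv i f x| ≤ C

lemma _root_.ContDiff.contDiffAt_natCast {f : ℝ → ℝ} (hf : ContDiff ℝ ∞ f) (i : ℕ) (x : ℝ) :
    ContDiffAt ℝ i f x :=
  hf.contDiffAt.of_le (by exact_mod_cast le_top)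

lemma DerivBound.mono {k : ℕ} {f : ℝ → ℝ} {C D : ℝ} (h : DerivBound k f C) (hCD : C ≤ D) :
    DerivBound k f D := fun i hi x => (h i hi x).trans hCD

lemma DerivBound.anti {k l : ℕ} {f : ℝ → ℝ} {C : ℝ} (h : DerivBound k f C) (hl : l ≤ k) :
    DerivBound l f C := fun i hi x => h i (hi.trans hl) x

lemma DerivBound.add {k : ℕ} {f g : ℝ → ℝ} {C D : ℝ} (hf : ContDiff ℝ ∞ f)
    (hg : ContDiff ℝ ∞ g) (h : DerivBound k f C) (h' : DerivBound k g D) :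
    DerivBound k (fun x => f x + g x) (C + D) := by
  intro i hi x
  rw [iteratedDeriv_fun_add (hf.contDiffAt_natCast i x) (hg.contDiffAt_natCast i x)]
  exact (abs_add_le _ _).trans (add_le_add (h i hi x) (h' i hi x))

lemma DerivBound.const_mul {k : ℕ} {f : ℝ → ℝ} {C a : ℝ} (hf : ContDiff ℝ ∞ f)
    (ha : 0 ≤ a) (h : DerivBound k f C) : DerivBound k (fun x => a * f x) (a * C) := by
  intro i hi x
  rw [iteratedDeriv_const_mul a (hf.contDiffAt_natCast i x), abs_mul, abs_of_nonneg ha]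
  exact mul_le_mul_of_nonneg_left (h i hi x) ha

lemma exists_derivBound {f : ℝ → ℝ} (hf : ContDiff ℝ ∞ f) (hc : HasCompactSupport f) (k : ℕ) :
    ∃ C, DerivBound k f C := by
  have h : ∀ i, ∃ C, ∀ x, |iteratedDeriv i f x| ≤ C := by
    intro i
    have h1 := hc.iteratedFDeriv (𝕜 := ℝ) i
    have h2 : Continuous (iteratedFDeriv ℝ i f) :=
      hf.continuous_iteratedFDeriv (by exact_mod_cast le_top)
    obtain ⟨C, hC⟩ := h1.exists_bound_of_continuous h2
    refine ⟨C, fun x => ?_⟩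
    rw [← Real.norm_eq_abs, ← norm_iteratedFDeriv_eq_norm_iteratedDeriv]
    exact hC x
  choose C hC using h
  refine ⟨∑ i ∈ Finset.range (k + 1), |C i|, fun i hi x => ?_⟩
  refine ((hC i x).trans (le_abs_self _)).trans ?_
  exact Finset.single_le_sum (f := fun i => |C i|) (fun _ _ => abs_nonneg _)
    (Finset.mem_range.2 (by omega))

lemma exists_uniform_bound {P : ℕ → ℝ → Prop} (hmono : ∀ j C D, C ≤ D → P j C → P j D)
    (h : ∀ j, ∃ C, P j C) (K : ℕ) : ∃ C, 0 ≤ C ∧ ∀ j < K, P j C := by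
  choose C hC using h
  refine ⟨∑ i ∈ Finset.range K, |C i|, Finset.sum_nonneg fun _ _ => abs_nonneg _, fun j hj => ?_⟩
  refine hmono j (C j) _ ((le_abs_self _).trans ?_) (hC j)
  exact Finset.single_le_sum (f := fun i => |C i|) (fun _ _ => abs_nonneg _)
    (Finset.mem_range.2 hj)

/-- A discrete walk `p` on the line together with smooth occupation functions `S`: the step from
`p j` to `p (j + 1)` increases `S` precisely on the open interval between these two points. -/
structure Walk where
  /-- occupation functions -/
  S : ℕ → ℝ → ℝ
  /-- vertices -/
  p : ℕ → ℝ
  smooth : ∀ j, ContDiff ℝ ∞ (S j)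
  le_succ : ∀ j x, S j x ≤ S (j + 1) x
  lt_succ_iff : ∀ j x, S j x < S (j + 1) x ↔ (x - p j) * (x - p (j + 1)) < 0
  ne_succ : ∀ j, p j ≠ p (j + 1)

/-- Position, in thirds of the edge, of the zigzag walk after `e` steps modulo `6`. -/
def zigzag : ℕ → ℝ
  | 0 => 0 | 1 => 2 | 2 => 1 | 3 => 3 | 4 => 1 | _ => 2

/-- Weight accumulated by the zigzag walk within the current crossing. -/
def zigzagWeight : ℕ → ℝ → ℝ
  | 0 => fun _ => 0 | 1 => fun s => (1 - s) ^ 2 | 2 => fun s => 1 - s ^ 2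
  | 3 => fun _ => 0 | 4 => fun s => s ^ 2 | _ => fun s => 1 - (1 - s) ^ 2

/-- Weight of a single step of the zigzag walk. -/
def zigzagStep : ℕ → ℝ → ℝ
  | 0 => fun s => (1 - s) ^ 2 | 1 => fun s => 2 * s * (1 - s) | 2 => fun s => s ^ 2
  | 3 => fun s => s ^ 2 | 4 => fun s => 2 * s * (1 - s) | _ => fun s => (1 - s) ^ 2

/-- Total weight accumulated by the zigzag walk after `r` steps. -/
def zigzagSum (r : ℕ) (s : ℝ) : ℝ := (r / 3 : ℕ) + zigzagWeight (r % 6) s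

lemma zigzagSum_succ (r : ℕ) (s : ℝ) :
    zigzagSum (r + 1) s = zigzagSum r s + zigzagStep (r % 6) s := by
  obtain ⟨l, e, he, rfl⟩ : ∃ l e, e < 6 ∧ r = 6 * l + e :=
    ⟨r / 6, r % 6, Nat.mod_lt _ (by norm_num), by omega⟩
  have h1 : (6 * l + e) % 6 = e := by omega
  unfold zigzagSum
  rw [h1]
  interval_cases e
  · rw [show (6 * l + 0 + 1) % 6 = 1 by omega, show (6 * l + 0 + 1) / 3 = 2 * l by omega,
      show (6 * l + 0) / 3 = 2 * l by omega]
    simp only [zigzagWeight, zigzagStep]; ring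
  · rw [show (6 * l + 1 + 1) % 6 = 2 by omega, show (6 * l + 1 + 1) / 3 = 2 * l by omega,
      show (6 * l + 1) / 3 = 2 * l by omega]
    simp only [zigzagWeight, zigzagStep]; ring
  · rw [show (6 * l + 2 + 1) % 6 = 3 by omega, show (6 * l + 2 + 1) / 3 = 2 * l + 1 by omega,
      show (6 * l + 2) / 3 = 2 * l by omega]
    simp only [zigzagWeight, zigzagStep]; push_cast; ring
  · rw [show (6 * l + 3 + 1) % 6 = 4 by omega, show (6 * l + 3 + 1) / 3 = 2 * l + 1 by omega,
      show (6 * l + 3) / 3 = 2 * l + 1 by omega]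
    simp only [zigzagWeight, zigzagStep]; ring
  · rw [show (6 * l + 4 + 1) % 6 = 5 by omega, show (6 * l + 4 + 1) / 3 = 2 * l + 1 by omega,
      show (6 * l + 4) / 3 = 2 * l + 1 by omega]
    simp only [zigzagWeight, zigzagStep]; ring
  · rw [show (6 * l + 5 + 1) % 6 = 0 by omega, show (6 * l + 5 + 1) / 3 = 2 * l + 2 by omega,
      show (6 * l + 5) / 3 = 2 * l + 1 by omega]
    simp only [zigzagWeight, zigzagStep]; push_cast; ring

lemma zigzagWeight_contDiff (e : ℕ) : ContDiff ℝ ∞ (zigzagWeight e) := by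
  unfold zigzagWeight
  split <;> fun_prop

lemma zigzagStep_contDiff (e : ℕ) : ContDiff ℝ ∞ (zigzagStep e) := by
  unfold zigzagStep
  split <;> fun_prop

lemma zigzagStep_nonneg (e : ℕ) {s : ℝ} (h0 : 0 ≤ s) (h1 : s ≤ 1) : 0 ≤ zigzagStep e s := by
  have : 0 ≤ 1 - s := by linarith
  unfold zigzagStep
  split <;> positivity

/-- Smooth cutoff along the edge from `p` to `q`, changing in its middle third. -/
noncomputable def cutoff (p q x : ℝ) : ℝ :=
  Real.smoothTransition (3 * ((x - p) / (q - p)) - 1)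

lemma cutoff_contDiff (p q : ℝ) : ContDiff ℝ ∞ (cutoff p q) := by
  unfold cutoff
  exact Real.smoothTransition.contDiff.comp (by fun_prop)

lemma cutoff_nonneg (p q x : ℝ) : 0 ≤ cutoff p q x := Real.smoothTransition.nonneg _

lemma cutoff_le_one (p q x : ℝ) : cutoff p q x ≤ 1 := Real.smoothTransition.le_one _

lemma cutoff_pos_iff (p q x : ℝ) : 0 < cutoff p q x ↔ 1 / 3 < (x - p) / (q - p) := by
  rw [(cutoff_nonneg p q x).lt_iff_ne', cutoff, Ne, Real.smoothTransition.zero_iff_nonpos, not_le]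
  constructor <;> intro h <;> linarith

lemma cutoff_lt_one_iff (p q x : ℝ) : cutoff p q x < 1 ↔ (x - p) / (q - p) < 2 / 3 := by
  constructor
  · intro h
    by_contra! h'
    exact h.ne (Real.smoothTransition.one_of_one_le (by linarith))
  · intro h
    exact Real.smoothTransition.lt_one_of_lt_one (by linarith)

lemma sub_mul_sub_neg_iff (u a b : ℝ) (hab : a < b) :
    (u - a) * (u - b) < 0 ↔ a < u ∧ u < b := by
  rw [mul_neg_iff]
  constructor
  · rintro (⟨h1, h2⟩ | ⟨h1, h2⟩) <;> constructor <;> linarith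
  · rintro ⟨h1, h2⟩
    left; constructor <;> linarith

/-- Vertices of the zigzag walk on the edge from `p` to `q`. -/
noncomputable def zigzagPoint (p q : ℝ) (r : ℕ) : ℝ := p + (q - p) * (zigzag (r % 6) / 3)

lemma succ_mod_six {r e : ℕ} (h : r % 6 = e) : (r + 1) % 6 = (e + 1) % 6 := by omega

lemma zigzagStep_pos_iff {p q : ℝ} (hpq : p ≠ q) (r : ℕ) (x : ℝ) :
    ((x - p) * (x - q) < 0 ∧ 0 < zigzagStep (r % 6) (cutoff p q x)) ↔
      (x - zigzagPoint p q r) * (x - zigzagPoint p q (r + 1)) < 0 := by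
  have hd : q - p ≠ 0 := sub_ne_zero.2 hpq.symm
  have hd2 : 0 < (q - p) ^ 2 := by positivity
  set u := (x - p) / (q - p) with hu
  have hx : x = p + (q - p) * u := by rw [hu]; field_simp; ring
  have key : ∀ a b : ℝ, (x - (p + (q - p) * a)) * (x - (p + (q - p) * b)) < 0 ↔
      (u - a) * (u - b) < 0 := by
    intro a b
    have : (x - (p + (q - p) * a)) * (x - (p + (q - p) * b)) =
        (q - p) ^ 2 * ((u - a) * (u - b)) := by rw [hx]; ring
    rw [this, mul_neg_iff]
    constructor
    · rintro (h | h)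
      · exact h.2
      · exact absurd h.1 (not_lt.2 hd2.le)
    · intro h; exact Or.inl ⟨hd2, h⟩
  have h01 : (x - p) * (x - q) < 0 ↔ 0 < u ∧ u < 1 := by
    have := key 0 1
    rw [sub_mul_sub_neg_iff u 0 1 one_pos] at this
    rw [← this]
    ring_nf
  have hpos := cutoff_pos_iff p q x
  have hlt := cutoff_lt_one_iff p q x
  rw [← hu] at hpos hlt
  set s := cutoff p q x
  have h0 : 0 ≤ s := cutoff_nonneg p q x
  have h1 : s ≤ 1 := cutoff_le_one p q x
  have hA : 0 < (1 - s) ^ 2 ↔ u < 2 / 3 := by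
    rw [← hlt, sq_pos_iff, sub_ne_zero]
    exact ⟨fun h => lt_of_le_of_ne h1 h.symm, fun h => h.ne'⟩
  have hC : 0 < s ^ 2 ↔ 1 / 3 < u := by
    rw [← hpos, sq_pos_iff]
    exact ⟨fun h => lt_of_le_of_ne h0 h.symm, fun h => h.ne'⟩
  have hB : 0 < 2 * s * (1 - s) ↔ 1 / 3 < u ∧ u < 2 / 3 := by
    rw [← hpos, ← hlt]
    constructor
    · intro h
      have hs : 0 < s := lt_of_le_of_ne h0 (by rintro h'; rw [← h'] at h; simp at h)
      refine ⟨hs, lt_of_le_of_ne h1 (by rintro h'; rw [h'] at h; simp at h)⟩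
    · rintro ⟨h2, h3⟩
      have : 0 < 1 - s := by linarith
      positivity
  rw [zigzagPoint, zigzagPoint, key, h01]
  have he : r % 6 < 6 := Nat.mod_lt _ (by norm_num)
  rw [succ_mod_six rfl]
  set e := r % 6
  clear_value e
  interval_cases e
  · simp only [zigzagStep, zigzag, hA]
    rw [sub_mul_sub_neg_iff _ _ _ (by norm_num)]
    grind
  · simp only [zigzagStep, zigzag, hB]
    rw [mul_comm, sub_mul_sub_neg_iff _ _ _ (by norm_num)]
    grind
  · simp only [zigzagStep, zigzag, hC]
    rw [sub_mul_sub_neg_iff _ _ _ (by norm_num)]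
    grind
  · simp only [zigzagStep, zigzag, hC]
    rw [mul_comm, sub_mul_sub_neg_iff _ _ _ (by norm_num)]
    grind
  · simp only [zigzagStep, zigzag, hB]
    rw [sub_mul_sub_neg_iff _ _ _ (by norm_num)]
    grind
  · simp only [zigzagStep, zigzag, hA]
    rw [mul_comm, sub_mul_sub_neg_iff _ _ _ (by norm_num)]
    grind


namespace Walk

variable (W : Walk)

/-- Increment of the occupation function along the `j`-th step. -/
def incr (j : ℕ) (x : ℝ) : ℝ := W.S (j + 1) x - W.S j x

lemma incr_contDiff (j : ℕ) : ContDiff ℝ ∞ (W.incr j) := (W.smooth (j + 1)).sub (W.smooth j)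

lemma incr_nonneg (j : ℕ) (x : ℝ) : 0 ≤ W.incr j x := sub_nonneg.2 (W.le_succ j x)

lemma incr_pos_iff (j : ℕ) (x : ℝ) :
    0 < W.incr j x ↔ (x - W.p j) * (x - W.p (j + 1)) < 0 := by
  rw [incr, sub_pos, W.lt_succ_iff]

lemma incr_mul_hasCompactSupport (j : ℕ) (g : ℝ → ℝ) :
    HasCompactSupport (fun x => W.incr j x * g x) := by
  refine HasCompactSupport.intro (isCompact_uIcc (a := W.p j) (b := W.p (j + 1))) fun x hx => ?_
  have h : ¬ 0 < W.incr j x := by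
    rw [incr_pos_iff]
    intro h
    apply hx
    rw [mem_uIcc]
    rcases mul_neg_iff.1 h with ⟨h1, h2⟩ | ⟨h1, h2⟩
    · left; constructor <;> linarith
    · right; constructor <;> linarith
  have : W.incr j x = 0 := le_antisymm (not_lt.1 h) (W.incr_nonneg j x)
  simp [this]

/-- Occupation function after `r` steps of a zigzag walk crossing the `j`-th edge
`2 * m + 1` times. -/
noncomputable def zigzagS (m j r : ℕ) (x : ℝ) : ℝ :=
  W.S j x + W.incr j x * (zigzagSum r (cutoff (W.p j) (W.p (j + 1)) x) / (2 * m + 1 : ℕ))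

lemma zigzagS_zero (m j : ℕ) : W.zigzagS m j 0 = W.S j := by
  ext x; simp [zigzagS, zigzagSum, zigzagWeight]

lemma zigzagS_last (m j : ℕ) : W.zigzagS m j (3 * (2 * m + 1)) = W.S (j + 1) := by
  ext x
  have h1 : 3 * (2 * m + 1) / 3 = 2 * m + 1 := by omega
  have h2 : 3 * (2 * m + 1) % 6 = 3 := by omega
  have h3 : ((2 * m + 1 : ℕ) : ℝ) ≠ 0 := by positivity
  simp only [zigzagS, zigzagSum, h1, h2, zigzagWeight, add_zero, incr]
  rw [div_self h3]; ring

lemma zigzagPoint_zero (p q : ℝ) : zigzagPoint p q 0 = p := by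
  simp [zigzagPoint, zigzag]

lemma zigzagPoint_last (p q : ℝ) (m : ℕ) : zigzagPoint p q (3 * (2 * m + 1)) = q := by
  have h2 : 3 * (2 * m + 1) % 6 = 3 := by omega
  simp [zigzagPoint, zigzag, h2]

lemma zigzagS_succ (m j r : ℕ) (x : ℝ) :
    W.zigzagS m j (r + 1) x = W.zigzagS m j r x +
      W.incr j x * (zigzagStep (r % 6) (cutoff (W.p j) (W.p (j + 1)) x) / (2 * m + 1 : ℕ)) := by
  simp only [zigzagS, zigzagSum_succ]; ring

lemma zigzagSum_contDiff (r : ℕ) : ContDiff ℝ ∞ (zigzagSum r) := by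
  unfold zigzagSum
  exact contDiff_const.add (zigzagWeight_contDiff _)

lemma zigzagS_contDiff (m j r : ℕ) : ContDiff ℝ ∞ (W.zigzagS m j r) := by
  unfold zigzagS
  exact (W.smooth j).add ((W.incr_contDiff j).mul
    (((zigzagSum_contDiff r).comp (cutoff_contDiff _ _)).div_const _))

lemma div_mod_succ {N : ℕ} (hN : 0 < N) (i : ℕ) :
    ((i + 1) / N = i / N ∧ (i + 1) % N = i % N + 1) ∨
      ((i + 1) / N = i / N + 1 ∧ (i + 1) % N = 0 ∧ i % N + 1 = N) := by
  have hlt := Nat.mod_lt i hN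
  have h := Nat.div_add_mod i N
  rcases Nat.lt_or_ge (i % N + 1) N with h1 | h1
  · left
    have : i + 1 = (i % N + 1) + N * (i / N) := by omega
    constructor
    · conv_lhs => rw [this, Nat.add_mul_div_left _ _ hN, Nat.div_eq_of_lt h1]
      simp
    · conv_lhs => rw [this, Nat.add_mul_mod_self_left, Nat.mod_eq_of_lt h1]
  · right
    have h2 : i % N + 1 = N := by omega
    have : i + 1 = N * (i / N + 1) := by rw [mul_add]; omega
    refine ⟨?_, ?_, h2⟩
    · conv_lhs => rw [this, Nat.mul_div_cancel_left _ hN]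
    · conv_lhs => rw [this, Nat.mul_mod_right]

lemma exists_eq_of_zigzag {α : Type*} (f : ℕ → ℕ → α) (m : ℕ)
    (hf : ∀ j, f j (3 * (2 * m + 1)) = f (j + 1) 0) (i : ℕ) :
    f ((i + 1) / (3 * (2 * m + 1))) ((i + 1) % (3 * (2 * m + 1))) =
      f (i / (3 * (2 * m + 1))) (i % (3 * (2 * m + 1)) + 1) := by
  rcases div_mod_succ (N := 3 * (2 * m + 1)) (by omega) i with ⟨h1, h2⟩ | ⟨h1, h2, h3⟩
  · rw [h1, h2]
  · rw [h1, h2, h3, hf]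

/-- Occupation functions of the refined walk. -/
noncomputable def refineS (m i : ℕ) : ℝ → ℝ :=
  W.zigzagS m (i / (3 * (2 * m + 1))) (i % (3 * (2 * m + 1)))

/-- Vertices of the refined walk. -/
noncomputable def refineP (m i : ℕ) : ℝ :=
  zigzagPoint (W.p (i / (3 * (2 * m + 1)))) (W.p (i / (3 * (2 * m + 1)) + 1))
    (i % (3 * (2 * m + 1)))

lemma refineS_succ (m i : ℕ) : W.refineS m (i + 1) =
    W.zigzagS m (i / (3 * (2 * m + 1))) (i % (3 * (2 * m + 1)) + 1) :=
  exists_eq_of_zigzag (fun j r => W.zigzagS m j r) m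
    (fun j => by simp only [zigzagS_last, zigzagS_zero]) i

lemma refineP_succ (m i : ℕ) : W.refineP m (i + 1) =
    zigzagPoint (W.p (i / (3 * (2 * m + 1)))) (W.p (i / (3 * (2 * m + 1)) + 1))
      (i % (3 * (2 * m + 1)) + 1) :=
  exists_eq_of_zigzag (fun j r => zigzagPoint (W.p j) (W.p (j + 1)) r) m
    (fun j => by simp only [zigzagPoint_last, zigzagPoint_zero]) i

lemma zigzagPoint_ne (p q : ℝ) (h : p ≠ q) (r : ℕ) :
    zigzagPoint p q r ≠ zigzagPoint p q (r + 1) := by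
  unfold zigzagPoint
  have hd : q - p ≠ 0 := sub_ne_zero.2 h.symm
  have he : r % 6 < 6 := Nat.mod_lt _ (by norm_num)
  rw [succ_mod_six rfl]
  set e := r % 6
  clear_value e
  intro h'
  have := mul_left_cancel₀ hd (add_left_cancel h')
  interval_cases e <;> norm_num [zigzag] at this

lemma abs_zigzagPoint_sub_le (p q : ℝ) (r : ℕ) : |zigzagPoint p q r - p| ≤ |q - p| := by
  have : zigzagPoint p q r - p = (q - p) * (zigzag (r % 6) / 3) := by unfold zigzagPoint; ring
  rw [this, abs_mul]
  refine mul_le_of_le_one_right (abs_nonneg _) ?_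
  unfold zigzag
  split <;> norm_num [abs_le]

lemma abs_zigzagPoint_succ_sub_le (p q : ℝ) (r : ℕ) :
    |zigzagPoint p q (r + 1) - zigzagPoint p q r| ≤ 2 / 3 * |q - p| := by
  have : zigzagPoint p q (r + 1) - zigzagPoint p q r =
      (zigzag ((r + 1) % 6) / 3 - zigzag (r % 6) / 3) * (q - p) := by unfold zigzagPoint; ring
  rw [this, abs_mul]
  refine mul_le_mul_of_nonneg_right ?_ (abs_nonneg _)
  have he : r % 6 < 6 := Nat.mod_lt _ (by norm_num)
  rw [succ_mod_six rfl]
  set e := r % 6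
  clear_value e
  interval_cases e <;> norm_num [zigzag, abs_le]

/-- Replace every edge by a zigzag walk crossing it `2 * m + 1` times. -/
noncomputable def refine (m : ℕ) : Walk where
  S := W.refineS m
  p := W.refineP m
  smooth i := W.zigzagS_contDiff _ _ _
  le_succ i x := by
    rw [refineS_succ, zigzagS_succ, refineS]
    refine le_add_of_nonneg_right (mul_nonneg (W.incr_nonneg _ _) (div_nonneg ?_ (by positivity)))
    exact zigzagStep_nonneg _ (cutoff_nonneg _ _ _) (cutoff_le_one _ _ _)
  lt_succ_iff i x := by
    rw [refineS_succ, zigzagS_succ, refineS, refineP_succ, refineP,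
      ← zigzagStep_pos_iff (W.ne_succ _), ← incr_pos_iff, lt_add_iff_pos_right]
    have hM : (0 : ℝ) < (2 * m + 1 : ℕ) := by positivity
    constructor
    · intro h
      have h1 := (pos_iff_pos_of_mul_pos h)
      rcases (W.incr_nonneg (i / (3 * (2 * m + 1))) x).eq_or_lt with h0 | h0
      · rw [← h0] at h; simp at h
      · exact ⟨h0, (div_pos_iff_of_pos_right hM).1 (h1.1 h0)⟩
    · rintro ⟨h1, h2⟩
      exact mul_pos h1 (div_pos h2 hM)
  ne_succ i := by
    rw [refineP_succ, refineP]
    exact zigzagPoint_ne _ _ (W.ne_succ _) _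

end Walk

/-- `W'` refines `W` by replacing every edge by `N` edges, with control of order `k` and precision
`ε` on the first `K` edges. -/
structure IsRefinement (W W' : Walk) (K N k : ℕ) (ε : ℝ) : Prop where
  two_le : 2 ≤ N
  S_mul : ∀ j, W'.S (j * N) = W.S j
  p_mul : ∀ j, W'.p (j * N) = W.p j
  p_sub : ∀ j, ∀ i < N, |W'.p (j * N + i) - W.p j| ≤ |W.p (j + 1) - W.p j|
  p_succ : ∀ j, ∀ i < N,
    |W'.p (j * N + i + 1) - W'.p (j * N + i)| ≤ 2 / 3 * |W.p (j + 1) - W.p j|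
  S_succ : ∀ j < K, ∀ i < N, DerivBound k (W'.incr (j * N + i)) ε
  S_sub : ∀ j < K, ∀ i < N, ∀ l ≤ k, ∀ η, 0 ≤ η → DerivBound l (W.incr j) η →
    DerivBound l (fun x => W'.S (j * N + i) x - W.S j x) (η + ε)

lemma exists_isRefinement (W : Walk) (K k : ℕ) {ε : ℝ} (hε : 0 < ε) :
    ∃ W' N, IsRefinement W W' K N k ε := by
  have hcomp : ∀ j (f : ℝ → ℝ), ContDiff ℝ ∞ f → ContDiff ℝ ∞
      (fun x => W.incr j x * f (cutoff (W.p j) (W.p (j + 1)) x)) := fun j f hf =>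
    (W.incr_contDiff j).mul (hf.comp (cutoff_contDiff _ _))
  have hbd : ∀ (f : ℕ → ℝ → ℝ), (∀ e, ContDiff ℝ ∞ (f e)) → ∃ C, 0 ≤ C ∧ ∀ j < K, ∀ e < 6,
      DerivBound k (fun x => W.incr j x * f e (cutoff (W.p j) (W.p (j + 1)) x)) C := by
    intro f hf
    refine exists_uniform_bound (P := fun j C => ∀ e < 6,
      DerivBound k (fun x => W.incr j x * f e (cutoff (W.p j) (W.p (j + 1)) x)) C)
      (fun j C D h h' e he => (h' e he).mono h) (fun j => ?_) K
    obtain ⟨C, -, hC⟩ := exists_uniform_bound (P := fun e C =>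
      DerivBound k (fun x => W.incr j x * f e (cutoff (W.p j) (W.p (j + 1)) x)) C)
      (fun e C D h h' => h'.mono h)
      (fun e => exists_derivBound (hcomp j (f e) (hf e)) (W.incr_mul_hasCompactSupport j _) k) 6
    exact ⟨C, hC⟩
  obtain ⟨C, hC0, hC⟩ := hbd zigzagWeight zigzagWeight_contDiff
  obtain ⟨D, hD0, hD⟩ := hbd zigzagStep zigzagStep_contDiff
  obtain ⟨m, hm⟩ := exists_nat_gt ((C + D) / ε)
  have hM : (0 : ℝ) < (2 * m + 1 : ℕ) := by positivity
  have hinv : (0 : ℝ) ≤ ((2 * m + 1 : ℕ) : ℝ)⁻¹ := by positivity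
  have hCD : ((2 * m + 1 : ℕ) : ℝ)⁻¹ * (C + D) ≤ ε := by
    rw [inv_mul_le_iff₀ hM]
    rw [div_lt_iff₀ hε] at hm
    refine hm.le.trans (mul_le_mul_of_nonneg_right ?_ hε.le)
    push_cast
    have : (0 : ℝ) ≤ m := by positivity
    linarith
  have hC' : ((2 * m + 1 : ℕ) : ℝ)⁻¹ * C ≤ ε :=
    (mul_le_mul_of_nonneg_left (by linarith) hinv).trans hCD
  have hD' : ((2 * m + 1 : ℕ) : ℝ)⁻¹ * D ≤ ε :=
    (mul_le_mul_of_nonneg_left (by linarith) hinv).trans hCD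
  have hmod6 : ∀ r, r % 6 < 6 := fun r => Nat.mod_lt _ (by norm_num)
  have hdiv : ∀ j, ∀ i < 3 * (2 * m + 1), (j * (3 * (2 * m + 1)) + i) / (3 * (2 * m + 1)) = j := by
    intro j i hi
    rw [mul_comm j, Nat.mul_add_div (by omega), Nat.div_eq_of_lt hi, add_zero]
  have hmod : ∀ j, ∀ i < 3 * (2 * m + 1), (j * (3 * (2 * m + 1)) + i) % (3 * (2 * m + 1)) = i := by
    intro j i hi
    rw [mul_comm j, Nat.mul_add_mod, Nat.mod_eq_of_lt hi]
  have hdiv0 := fun j => hdiv j 0 (by omega)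
  have hmod0 := fun j => hmod j 0 (by omega)
  simp only [add_zero] at hdiv0 hmod0
  refine ⟨W.refine m, 3 * (2 * m + 1), by omega, ?_, ?_, ?_, ?_, ?_, ?_⟩
  · intro j
    simp only [Walk.refine, Walk.refineS, hdiv0, hmod0, Walk.zigzagS_zero]
  · intro j
    simp only [Walk.refine, Walk.refineP, hdiv0, hmod0, Walk.zigzagPoint_zero]
  · intro j i hi
    simp only [Walk.refine, Walk.refineP, hdiv j i hi, hmod j i hi]
    exact Walk.abs_zigzagPoint_sub_le _ _ _
  · intro j i hi
    simp only [Walk.refine]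
    rw [Walk.refineP_succ, Walk.refineP, hdiv j i hi, hmod j i hi]
    exact Walk.abs_zigzagPoint_succ_sub_le _ _ _
  · intro j hj i hi
    have : (W.refine m).incr (j * (3 * (2 * m + 1)) + i) = fun x =>
        ((2 * m + 1 : ℕ) : ℝ)⁻¹ *
          (W.incr j x * zigzagStep (i % 6) (cutoff (W.p j) (W.p (j + 1)) x)) := by
      ext x
      unfold Walk.incr
      simp only [Walk.refine]
      rw [Walk.refineS_succ, Walk.refineS, Walk.zigzagS_succ, hdiv j i hi, hmod j i hi, Walk.incr]
      ring
    rw [this]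
    exact ((hD j hj _ (hmod6 i)).const_mul (hcomp j _ (zigzagStep_contDiff _)) hinv).mono hD'
  · intro j hj i hi l hl η hη h
    have : (fun x => (W.refine m).S (j * (3 * (2 * m + 1)) + i) x - W.S j x) = fun x =>
        (((i / 3 : ℕ) : ℝ) * ((2 * m + 1 : ℕ) : ℝ)⁻¹) * W.incr j x + ((2 * m + 1 : ℕ) : ℝ)⁻¹ *
          (W.incr j x * zigzagWeight (i % 6) (cutoff (W.p j) (W.p (j + 1)) x)) := by
      ext x
      simp only [Walk.refine, Walk.refineS, Walk.zigzagS, hdiv j i hi, hmod j i hi, zigzagSum]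
      ring
    rw [this]
    refine DerivBound.add (contDiff_const.mul (W.incr_contDiff j))
      (contDiff_const.mul (hcomp j _ (zigzagWeight_contDiff _)))
      ((h.const_mul (W.incr_contDiff j) (by positivity)).mono ?_)
      ((((hC j hj _ (hmod6 i)).anti hl).const_mul
        (hcomp j _ (zigzagWeight_contDiff _)) hinv).mono hC')
    refine mul_le_of_le_one_left hη ?_
    rw [mul_inv_le_iff₀ hM, one_mul]
    exact_mod_cast (by omega : i / 3 ≤ 2 * m + 1)

/-- `K` is the sequence of partial products of `N`, whose terms are at least `2`. -/
structure IsAdic (K N : ℕ → ℕ) : Prop where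
  zero : K 0 = 1
  succ : ∀ n, K (n + 1) = K n * N n
  two_le : ∀ n, 2 ≤ N n

namespace IsAdic

variable {K N : ℕ → ℕ}

lemma two_pow_le (hK : IsAdic K N) (n : ℕ) : 2 ^ n ≤ K n := by
  induction n with
  | zero => simp [hK.zero]
  | succ n ih => rw [hK.succ, pow_succ]; exact Nat.mul_le_mul ih (hK.two_le n)

lemma pos (hK : IsAdic K N) (n : ℕ) : 0 < K n := (Nat.two_pow_pos n).trans_le (hK.two_pow_le n)

lemma cast_pos (hK : IsAdic K N) (n : ℕ) : (0 : ℝ) < K n := Nat.cast_pos.2 (hK.pos n)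

lemma exists_lt (hK : IsAdic K N) (x : ℝ) : ∃ n, x < K n := by
  obtain ⟨n, hn⟩ := pow_unbounded_of_one_lt x (one_lt_two : (1 : ℝ) < 2)
  exact ⟨n, hn.trans_le (by exact_mod_cast hK.two_pow_le n)⟩

lemma floor_lt (hK : IsAdic K N) {t : ℝ} (ht : t ∈ Ico (0 : ℝ) 1) (n : ℕ) : ⌊K n * t⌋₊ < K n := by
  rw [Nat.floor_lt (mul_nonneg (hK.cast_pos n).le ht.1)]
  exact mul_lt_of_lt_one_right (hK.cast_pos n) ht.2

lemma exists_floor_succ (hK : IsAdic K N) {t : ℝ} (n : ℕ) :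
    ∃ i < N n, ⌊K (n + 1) * t⌋₊ = ⌊K n * t⌋₊ * N n + i := by
  have hN : 0 < N n := two_pos.trans_le (hK.two_le n)
  refine ⟨⌊K (n + 1) * t⌋₊ % N n, Nat.mod_lt _ hN, ?_⟩
  have h : ⌊K n * t⌋₊ = ⌊K (n + 1) * t⌋₊ / N n := by
    rw [← Nat.floor_div_natCast, hK.succ]
    congr 1
    have : (N n : ℝ) ≠ 0 := by positivity
    push_cast; field_simp
  rw [h, Nat.div_add_mod']

end IsAdic

/-- Values `u n j` prescribed at the times `j / K n` in `[0, 1]`, compatible between levels and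
varying by at most `C * (2 / 3) ^ n` at level `n ≥ n₀`. -/
structure IsAdicPath (K N : ℕ → ℕ) (u : ℕ → ℕ → ℝ) (C : ℝ) (n₀ : ℕ) : Prop where
  mul : ∀ n j, u (n + 1) (j * N n) = u n j
  sub : ∀ n ≥ n₀, ∀ j < K n, ∀ i < N n, |u (n + 1) (j * N n + i) - u n j| ≤ C * (2 / 3) ^ n
  step : ∀ n ≥ n₀, ∀ j < K n, |u n (j + 1) - u n j| ≤ C * (2 / 3) ^ n

/-- The limit of the values of `u` at the adic approximations of the time `t`. -/
noncomputable def adicLim (K : ℕ → ℕ) (u : ℕ → ℕ → ℝ) (t : ℝ) : ℝ :=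
  limUnder atTop fun n => u n ⌊K n * t⌋₊

namespace IsAdicPath

variable {K N : ℕ → ℕ} {u : ℕ → ℕ → ℝ} {C : ℝ} {n₀ : ℕ}

lemma dist_succ_le (hK : IsAdic K N) (hu : IsAdicPath K N u C n₀) {t : ℝ}
    (ht : t ∈ Icc (0 : ℝ) 1) {n : ℕ} (hn : n₀ ≤ n) :
    dist (u n ⌊K n * t⌋₊) (u (n + 1) ⌊K (n + 1) * t⌋₊) ≤ C * (2 / 3) ^ n := by
  rw [dist_comm, Real.dist_eq]
  rcases ht.2.lt_or_eq with h | rfl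
  · obtain ⟨i, hi, h'⟩ := hK.exists_floor_succ (t := t) n
    rw [h']
    exact hu.sub n hn _ (hK.floor_lt ⟨ht.1, h⟩ n) i hi
  · simp only [mul_one, Nat.floor_natCast, hK.succ, hu.mul, sub_self, abs_zero]
    exact (abs_nonneg _).trans (hu.step n hn 0 (hK.pos n))

lemma tendsto_adicLim (hK : IsAdic K N) (hu : IsAdicPath K N u C n₀) {t : ℝ}
    (ht : t ∈ Icc (0 : ℝ) 1) :
    Tendsto (fun n => u n ⌊K n * t⌋₊) atTop (𝓝 (adicLim K u t)) := by
  have h : CauchySeq (fun n => u (n + n₀) ⌊K (n + n₀) * t⌋₊) := by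
    refine cauchySeq_of_le_geometric (2 / 3) (C * (2 / 3) ^ n₀) (by norm_num) fun n => ?_
    have := hu.dist_succ_le hK ht (n := n + n₀) (by omega)
    rw [show n + 1 + n₀ = n + n₀ + 1 by omega]
    exact this.trans_eq (by ring)
  obtain ⟨a, ha⟩ := cauchySeq_tendsto_of_complete h
  have ha' : Tendsto (fun n => u n ⌊K n * t⌋₊) atTop (𝓝 a) :=
    (tendsto_add_atTop_iff_nat (f := fun n => u n ⌊K n * t⌋₊) n₀).1 ha
  exact tendsto_nhds_limUnder ⟨a, ha'⟩

lemma dist_adicLim_le (hK : IsAdic K N) (hu : IsAdicPath K N u C n₀) {t : ℝ}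
    (ht : t ∈ Icc (0 : ℝ) 1) {n : ℕ} (hn : n₀ ≤ n) :
    dist (u n ⌊K n * t⌋₊) (adicLim K u t) ≤ 3 * C * (2 / 3) ^ n := by
  have h := dist_le_of_le_geometric_of_tendsto (2 / 3) (C * (2 / 3) ^ n) (by norm_num)
    (f := fun m => u (m + n) ⌊K (m + n) * t⌋₊) (fun m => by
      have := hu.dist_succ_le hK ht (n := m + n) (by omega)
      rw [show m + 1 + n = m + n + 1 by omega]
      exact this.trans_eq (by ring))
    ((tendsto_add_atTop_iff_nat (f := fun n => u n ⌊K n * t⌋₊) n).2 (hu.tendsto_adicLim hK ht)) 0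
  simp only [zero_add, pow_zero, mul_one] at h
  exact h.trans_eq (by ring)

lemma adicLim_eq (hK : IsAdic K N) (hu : IsAdicPath K N u C n₀) (n : ℕ) {j : ℕ} (hj : j ≤ K n) :
    adicLim K u (j / K n) = u n j := by
  have ht : (j / K n : ℝ) ∈ Icc (0 : ℝ) 1 :=
    ⟨by positivity, by rw [div_le_one (hK.cast_pos n)]; exact_mod_cast hj⟩
  have h : ∀ m, u (m + n) ⌊K (m + n) * (j / K n : ℝ)⌋₊ = u n j ∧
      ∃ l : ℕ, K (m + n) * (j / K n : ℝ) = l := by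
    intro m
    induction m with
    | zero =>
      have : (K n : ℝ) * (j / K n) = j := by have := (hK.cast_pos n).ne'; field_simp
      simp [this]
    | succ m ih =>
      obtain ⟨h1, l, hl⟩ := ih
      have h2 : K (m + 1 + n) * (j / K n : ℝ) = (l * N (m + n) : ℕ) := by
        rw [show m + 1 + n = m + n + 1 by omega, hK.succ]
        push_cast
        rw [← hl]; ring
      refine ⟨?_, _, h2⟩
      rw [h2, Nat.floor_natCast, ← h1, hl, Nat.floor_natCast,
        show m + 1 + n = m + n + 1 by omega, hu.mul]
  refine tendsto_nhds_unique ((tendsto_add_atTop_iff_nat n).2 (hu.tendsto_adicLim hK ht)) ?_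
  exact tendsto_const_nhds.congr fun m => (h m).1.symm

lemma floor_le_floor_add_one {n : ℕ} {s t : ℝ} (hs : 0 ≤ s) (h : K n * |t - s| < 1) :
    ⌊K n * t⌋₊ ≤ ⌊K n * s⌋₊ + 1 := by
  rw [← Nat.floor_add_one (by positivity)]
  refine Nat.floor_le_floor ?_
  have : (K n : ℝ) * (t - s) ≤ K n * |t - s| :=
    mul_le_mul_of_nonneg_left (le_abs_self _) (by positivity)
  linarith

lemma abs_adicLim_sub_le (hK : IsAdic K N) (hu : IsAdicPath K N u C n₀) {n : ℕ} (hn : n₀ ≤ n)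
    {s t : ℝ} (hs : s ∈ Icc (0 : ℝ) 1) (ht : t ∈ Icc (0 : ℝ) 1) (h : K n * |t - s| < 1) :
    |adicLim K u t - adicLim K u s| ≤ 7 * C * (2 / 3) ^ n := by
  wlog hst : s ≤ t generalizing s t
  · rw [abs_sub_comm]
    exact this ht hs (by rwa [abs_sub_comm]) (not_le.1 hst).le
  have hC : 0 ≤ C * (2 / 3) ^ n := (abs_nonneg _).trans (hu.step n hn 0 (hK.pos n))
  have h1 := hu.dist_adicLim_le hK hs hn
  have h2 := hu.dist_adicLim_le hK ht hn
  have h3 : dist (u n ⌊K n * t⌋₊) (u n ⌊K n * s⌋₊) ≤ C * (2 / 3) ^ n := by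
    have hle : ⌊K n * s⌋₊ ≤ ⌊K n * t⌋₊ :=
      Nat.floor_le_floor (mul_le_mul_of_nonneg_left hst (by positivity))
    rcases hle.eq_or_lt with he | hl
    · rw [he, dist_self]; exact hC
    · have he : ⌊K n * t⌋₊ = ⌊K n * s⌋₊ + 1 :=
        le_antisymm (floor_le_floor_add_one hs.1 h) hl
      have hlt : ⌊K n * s⌋₊ < K n := by
        refine hl.trans_le ?_
        refine Nat.floor_le_of_le ?_
        exact mul_le_of_le_one_right (by positivity) ht.2
      rw [he, Real.dist_eq]
      exact hu.step n hn _ hlt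
  rw [← Real.dist_eq]
  rw [dist_comm] at h2
  calc dist (adicLim K u t) (adicLim K u s)
      ≤ dist (adicLim K u t) (u n ⌊K n * t⌋₊) + dist (u n ⌊K n * t⌋₊) (u n ⌊K n * s⌋₊)
        + dist (u n ⌊K n * s⌋₊) (adicLim K u s) := dist_triangle4 _ _ _ _
    _ ≤ 7 * C * (2 / 3) ^ n := by linarith

end IsAdicPath

lemma tendsto_const_mul_two_thirds_pow (C : ℝ) :
    Tendsto (fun n : ℕ => C * (2 / 3 : ℝ) ^ n) atTop (𝓝 0) := by
  simpa using (tendsto_pow_atTop_nhds_zero_of_lt_one (by norm_num : (0 : ℝ) ≤ 2 / 3)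
    (by norm_num)).const_mul C

/-- A uniform family of adic paths is equicontinuous. -/
lemma exists_delta_adicLim {K N : ℕ → ℕ} (hK : IsAdic K N) (C : ℝ) (n₀ : ℕ) {ε : ℝ} (hε : 0 < ε) :
    ∃ δ > 0, ∀ u, IsAdicPath K N u C n₀ → ∀ s ∈ Icc (0 : ℝ) 1, ∀ t ∈ Icc (0 : ℝ) 1,
      |t - s| < δ → |adicLim K u t - adicLim K u s| < ε := by
  obtain ⟨n, hn, hn'⟩ := (((tendsto_const_mul_two_thirds_pow (7 * C)).eventually_lt_const hε).and
    (eventually_ge_atTop n₀)).exists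
  refine ⟨(K n : ℝ)⁻¹, inv_pos.2 (hK.cast_pos n), fun u hu s hs t ht h => ?_⟩
  refine (hu.abs_adicLim_sub_le hK hn' hs ht ?_).trans_lt hn
  have := mul_lt_mul_of_pos_left h (hK.cast_pos n)
  rwa [mul_inv_cancel₀ (hK.cast_pos n).ne'] at this

/-- A sequence of successive refinements with summable geometric precision. -/
structure IsTower (W : ℕ → Walk) (K N : ℕ → ℕ) : Prop where
  adic : IsAdic K N
  refinement : ∀ n, IsRefinement (W n) (W (n + 1)) (K n) (N n) (n + 1) ((2 / 3) ^ (n + 1))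

lemma exists_isTower (W₀ : Walk) : ∃ W K N, IsTower W K N ∧ W 0 = W₀ := by
  have h : ∀ (n : ℕ) (s : Walk × ℕ), ∃ W' N,
      IsRefinement s.1 W' s.2 N (n + 1) ((2 / 3) ^ (n + 1)) :=
    fun n s => exists_isRefinement s.1 s.2 (n + 1) (by positivity)
  choose f g hfg using h
  let F : ℕ → Walk × ℕ := fun n =>
    Nat.rec (W₀, 1) (fun n s => (f n s, s.2 * g n s)) n
  refine ⟨fun n => (F n).1, fun n => (F n).2, fun n => g n (F n), ⟨⟨rfl, fun n => rfl, ?_⟩, ?_⟩,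
    rfl⟩
  · exact fun n => (hfg n (F n)).two_le
  · exact fun n => hfg n (F n)

namespace IsTower

variable {W : ℕ → Walk} {K N : ℕ → ℕ}

lemma exists_index (hW : IsTower W K N) (n j : ℕ) (hj : j < K (n + 1)) :
    ∃ a < K n, ∃ i < N n, j = a * N n + i := by
  have hN : 0 < N n := two_pos.trans_le (hW.adic.two_le n)
  refine ⟨j / N n, ?_, j % N n, Nat.mod_lt _ hN, (Nat.div_add_mod' _ _).symm⟩
  rw [Nat.div_lt_iff_lt_mul hN, ← hW.adic.succ]
  exact hj

lemma derivBound_incr (hW : IsTower W K N) {n : ℕ} (hn : 1 ≤ n) {j : ℕ} (hj : j < K n) :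
    DerivBound n ((W n).incr j) ((2 / 3) ^ n) := by
  obtain ⟨n, rfl⟩ : ∃ m, n = m + 1 := ⟨n - 1, by omega⟩
  obtain ⟨a, ha, i, hi, rfl⟩ := hW.exists_index n j hj
  exact (hW.refinement n).S_succ a ha i hi

lemma abs_p_succ_sub_le (hW : IsTower W K N) (n : ℕ) : ∀ j < K n,
    |(W n).p (j + 1) - (W n).p j| ≤ |(W 0).p 1 - (W 0).p 0| * (2 / 3) ^ n := by
  induction n with
  | zero =>
    intro j hj
    rw [hW.adic.zero] at hj
    obtain rfl : j = 0 := by omega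
    simp
  | succ n ih =>
    intro j hj
    obtain ⟨a, ha, i, hi, rfl⟩ := hW.exists_index n j hj
    refine ((hW.refinement n).p_succ a i hi).trans ?_
    have := ih a ha
    rw [pow_succ]
    linarith

lemma isAdicPath_p (hW : IsTower W K N) :
    IsAdicPath K N (fun n => (W n).p) |(W 0).p 1 - (W 0).p 0| 0 where
  mul n := (hW.refinement n).p_mul
  sub n _ j hj i hi := ((hW.refinement n).p_sub j i hi).trans (hW.abs_p_succ_sub_le n j hj)
  step n _ := hW.abs_p_succ_sub_le n

lemma isAdicPath_S (hW : IsTower W K N) (k : ℕ) (x : ℝ) :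
    IsAdicPath K N (fun n j => iteratedDeriv k ((W n).S j) x) 2 (k + 1) where
  mul n j := by rw [(hW.refinement n).S_mul]
  sub n hn j hj i hi := by
    have h := (hW.refinement n).S_sub j hj i hi n (by omega) _ (by positivity)
      (hW.derivBound_incr (by omega) hj) k (by omega) x
    rw [iteratedDeriv_fun_sub (((W (n + 1)).smooth _).contDiffAt_natCast k x)
      (((W n).smooth _).contDiffAt_natCast k x)] at h
    refine h.trans ?_
    have : (0 : ℝ) ≤ (2 / 3) ^ n := by positivity
    rw [pow_succ]; linarith
  step n hn j hj := by
    have h := hW.derivBound_incr (by omega) hj k (by omega) x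
    unfold Walk.incr at h
    rw [iteratedDeriv_fun_sub (((W n).smooth _).contDiffAt_natCast k x)
      (((W n).smooth _).contDiffAt_natCast k x)] at h
    refine h.trans ?_
    have : (0 : ℝ) ≤ (2 / 3) ^ n := by positivity
    linarith

/-- Limit of the `k`-th derivatives of the occupation functions. -/
noncomputable def limDeriv (W : ℕ → Walk) (K : ℕ → ℕ) (k : ℕ) (t x : ℝ) : ℝ :=
  adicLim K (fun n j => iteratedDeriv k ((W n).S j) x) t

lemma hasDerivAt_limDeriv (hW : IsTower W K N) {t : ℝ} (ht : t ∈ Icc (0 : ℝ) 1) (k : ℕ) (x : ℝ) :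
    HasDerivAt (limDeriv W K k t) (limDeriv W K (k + 1) t x) x := by
  refine hasDerivAt_of_tendstoUniformly (l := atTop)
    (f := fun n y => iteratedDeriv k ((W n).S ⌊K n * t⌋₊) y)
    (f' := fun n y => iteratedDeriv (k + 1) ((W n).S ⌊K n * t⌋₊) y) ?_ ?_ ?_ x
  · rw [Metric.tendstoUniformly_iff]
    intro ε hε
    filter_upwards [(tendsto_const_mul_two_thirds_pow (3 * 2)).eventually_lt_const hε,
      eventually_ge_atTop (k + 1 + 1)] with n hn hn' y
    rw [dist_comm]
    exact ((hW.isAdicPath_S (k + 1) y).dist_adicLim_le hW.adic ht hn').trans_lt hn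
  · refine Eventually.of_forall fun n y => ?_
    rw [iteratedDeriv_succ]
    exact (((W n).smooth _).differentiable_iteratedDeriv k
      (by exact_mod_cast WithTop.coe_lt_top _) y).hasDerivAt
  · exact fun y => (hW.isAdicPath_S k y).tendsto_adicLim hW.adic ht

lemma iteratedDeriv_limDeriv (hW : IsTower W K N) {t : ℝ} (ht : t ∈ Icc (0 : ℝ) 1) (k : ℕ) :
    iteratedDeriv k (limDeriv W K 0 t) = limDeriv W K k t := by
  induction k with
  | zero => rfl
  | succ k ih =>
    ext x
    rw [iteratedDeriv_succ, ih, (hW.hasDerivAt_limDeriv ht k x).deriv]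

lemma contDiff_limDeriv (hW : IsTower W K N) {t : ℝ} (ht : t ∈ Icc (0 : ℝ) 1) :
    ContDiff ℝ ∞ (limDeriv W K 0 t) := by
  refine contDiff_of_differentiable_iteratedDeriv (n := ⊤) fun m _ => ?_
  rw [hW.iteratedDeriv_limDeriv ht]
  exact fun x => (hW.hasDerivAt_limDeriv ht m x).differentiableAt

lemma continuousOn_limDeriv (hW : IsTower W K N) (k : ℕ) :
    ContinuousOn (fun q : ℝ × ℝ => limDeriv W K k q.1 q.2) (Icc 0 1 ×ˢ univ) := by
  rintro ⟨t, x⟩ ⟨ht, -⟩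
  rw [Metric.continuousWithinAt_iff]
  intro ε hε
  obtain ⟨δ, hδ, h⟩ := exists_delta_adicLim hW.adic 2 (k + 1) (half_pos hε)
  have hc : ContinuousAt (limDeriv W K k t) x := (hW.hasDerivAt_limDeriv ht k x).continuousAt
  obtain ⟨δ', hδ', h'⟩ := Metric.continuousAt_iff.1 hc (ε / 2) (half_pos hε)
  refine ⟨min δ δ', lt_min hδ hδ', ?_⟩
  rintro ⟨s, y⟩ ⟨hs, -⟩ hd
  rw [Prod.dist_eq, max_lt_iff, lt_min_iff, lt_min_iff] at hd
  have h1 : |limDeriv W K k s y - limDeriv W K k t y| < ε / 2 :=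
    h _ (hW.isAdicPath_S k y) t ht s hs hd.1.1
  have h2 := h' hd.2.2
  calc dist (limDeriv W K k s y) (limDeriv W K k t x)
      ≤ dist (limDeriv W K k s y) (limDeriv W K k t y)
        + dist (limDeriv W K k t y) (limDeriv W K k t x) := dist_triangle _ _ _
    _ < ε := by rw [Real.dist_eq (limDeriv W K k s y)]; linarith

lemma limDeriv_zero_eq (hW : IsTower W K N) (n : ℕ) {j : ℕ} (hj : j ≤ K n) :
    limDeriv W K 0 (j / K n) = (W n).S j := by
  ext x
  exact (hW.isAdicPath_S 0 x).adicLim_eq hW.adic n hj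

lemma limDeriv_mono (hW : IsTower W K N) {s t : ℝ} (hs : s ∈ Icc (0 : ℝ) 1)
    (ht : t ∈ Icc (0 : ℝ) 1) (hst : s ≤ t) (x : ℝ) : limDeriv W K 0 s x ≤ limDeriv W K 0 t x := by
  refine le_of_tendsto_of_tendsto' ((hW.isAdicPath_S 0 x).tendsto_adicLim hW.adic hs)
    ((hW.isAdicPath_S 0 x).tendsto_adicLim hW.adic ht) fun n => ?_
  simp only [iteratedDeriv_zero]
  exact monotone_nat_of_le_succ (fun j => (W n).le_succ j x)
    (Nat.floor_le_floor (mul_le_mul_of_nonneg_left hst (by positivity)))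

/-- Limit of the positions of the walks. -/
noncomputable def limPoint (W : ℕ → Walk) (K : ℕ → ℕ) (t : ℝ) : ℝ :=
  adicLim K (fun n => (W n).p) t

lemma limPoint_eq (hW : IsTower W K N) (n : ℕ) {j : ℕ} (hj : j ≤ K n) :
    limPoint W K (j / K n) = (W n).p j :=
  hW.isAdicPath_p.adicLim_eq hW.adic n hj

lemma continuousOn_limPoint (hW : IsTower W K N) : ContinuousOn (limPoint W K) (Icc 0 1) := by
  intro t ht
  rw [Metric.continuousWithinAt_iff]
  intro ε hε
  obtain ⟨δ, hδ, h⟩ := exists_delta_adicLim hW.adic |(W 0).p 1 - (W 0).p 0| 0 hε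
  exact ⟨δ, hδ, fun s hs hd => h _ hW.isAdicPath_p t ht s hs hd⟩

lemma limPoint_eq_of_lt (hW : IsTower W K N) {s x : ℝ} (hs : s ∈ Ico (0 : ℝ) 1)
    (h : ∀ r ∈ Ioc s 1, limDeriv W K 0 s x < limDeriv W K 0 r x) : limPoint W K s = x := by
  have hs' : s ∈ Icc (0 : ℝ) 1 := ⟨hs.1, hs.2.le⟩
  refine tendsto_nhds_unique (hW.isAdicPath_p.tendsto_adicLim hW.adic hs') ?_
  rw [tendsto_iff_dist_tendsto_zero]
  refine squeeze_zero (fun _ => dist_nonneg) (fun n => ?_)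
    (tendsto_const_mul_two_thirds_pow |(W 0).p 1 - (W 0).p 0|)
  set j := ⌊K n * s⌋₊ with hj
  have hK := hW.adic.cast_pos n
  have hjK : j < K n := hW.adic.floor_lt hs n
  have hjK' : (j + 1 : ℝ) ≤ K n := by exact_mod_cast hjK
  have h0 : (j / K n : ℝ) ≤ s := by
    rw [div_le_iff₀' hK]; exact Nat.floor_le (mul_nonneg hK.le hs.1)
  have h1 : s < ((j + 1 : ℕ) / K n : ℝ) := by
    rw [lt_div_iff₀' hK]; push_cast; exact Nat.lt_floor_add_one _
  have h2 : ((j + 1 : ℕ) / K n : ℝ) ≤ 1 := by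
    rw [div_le_one hK]; push_cast; exact hjK'
  have h3 := h _ ⟨h1, h2⟩
  have h4 := hW.limDeriv_mono ⟨by positivity, h0.trans hs'.2⟩ hs' h0 x
  have h5 := h4.trans_lt h3
  rw [hW.limDeriv_zero_eq n hjK.le, hW.limDeriv_zero_eq n hjK, (W n).lt_succ_iff] at h5
  refine le_trans ?_ (hW.abs_p_succ_sub_le n j hjK)
  rw [Real.dist_eq]
  rcases mul_neg_iff.1 h5 with ⟨h6, h7⟩ | ⟨h6, h7⟩
  · rw [abs_sub_comm]
    exact abs_le_abs_of_nonneg h6.le (by linarith)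
  · rw [abs_sub_comm ((W n).p (j + 1))]
    exact abs_le_abs_of_nonneg (by linarith) (by linarith)

lemma exists_limDeriv_lt (hW : IsTower W K N) {a b : ℝ} (ha : 0 ≤ a) (hab : a < b) (hb : b ≤ 1) :
    ∃ x, limDeriv W K 0 a x < limDeriv W K 0 b x := by
  obtain ⟨n, hn⟩ := hW.adic.exists_lt (2 / (b - a))
  have hK := hW.adic.cast_pos n
  rw [div_lt_iff₀ (by linarith)] at hn
  set j := ⌊K n * a⌋₊ + 1 with hj
  have hj1 : (j : ℝ) ≤ K n * a + 1 := by
    rw [hj]; push_cast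
    linarith [Nat.floor_le (mul_nonneg hK.le ha)]
  have hj2 : K n * a < j := by
    rw [hj]; push_cast; exact Nat.lt_floor_add_one _
  have h0 : a ≤ (j / K n : ℝ) := by rw [le_div_iff₀' hK]; exact hj2.le
  have h1 : ((j + 1 : ℕ) / K n : ℝ) ≤ b := by
    rw [div_le_iff₀' hK]; push_cast; nlinarith
  have h01 : (j / K n : ℝ) ≤ ((j + 1 : ℕ) / K n : ℝ) := by
    rw [div_le_div_iff_of_pos_right hK]; push_cast; linarith
  have hjK : j + 1 ≤ K n := by
    have := h1.trans hb
    rw [div_le_one hK] at this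
    exact_mod_cast this
  refine ⟨((W n).p j + (W n).p (j + 1)) / 2, ?_⟩
  refine (hW.limDeriv_mono ⟨ha, by linarith⟩ ⟨by positivity, by linarith⟩ h0 _).trans_lt
    (lt_of_lt_of_le ?_
      (hW.limDeriv_mono ⟨by positivity, by linarith⟩ ⟨by linarith, hb⟩ h1 _))
  rw [hW.limDeriv_zero_eq n hjK, hW.limDeriv_zero_eq n (by omega), (W n).lt_succ_iff]
  have : 0 < ((W n).p (j + 1) - (W n).p j) ^ 2 :=
    sq_pos_iff.2 (sub_ne_zero.2 ((W n).ne_succ j).symm)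
  nlinarith

end IsTower

/-- A continuous path `X` on the line with smooth occupation functions `G`. -/
structure IsLineFlow (G : ℝ → ℝ → ℝ) (X : ℝ → ℝ) : Prop where
  contDiff : ∀ t ∈ Icc (0 : ℝ) 1, ContDiff ℝ ∞ (G t)
  continuousOn : ∀ k, ContinuousOn (fun q : ℝ × ℝ => iteratedDeriv k (G q.1) q.2)
    (Icc 0 1 ×ˢ univ)
  path : ContinuousOn X (Icc 0 1)
  mono : ∀ s ∈ Icc (0 : ℝ) 1, ∀ t ∈ Icc (0 : ℝ) 1, s ≤ t → ∀ x, G s x ≤ G t x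
  eq_of_lt : ∀ s ∈ Ico (0 : ℝ) 1, ∀ x, (∀ r ∈ Ioc s 1, G s x < G r x) → X s = x
  exists_lt : ∀ a b, 0 ≤ a → a < b → b ≤ 1 → ∃ x, G a x < G b x

lemma exists_isLineFlow (W₀ : Walk) : ∃ G X, IsLineFlow G X ∧ G 0 = W₀.S 0 ∧ G 1 = W₀.S 1 ∧
    X 0 = W₀.p 0 ∧ X 1 = W₀.p 1 := by
  obtain ⟨W, K, N, hW, rfl⟩ := exists_isTower W₀
  refine ⟨IsTower.limDeriv W K 0, IsTower.limPoint W K, ⟨fun t => hW.contDiff_limDeriv,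
    fun k => ?_, hW.continuousOn_limPoint, fun s hs t ht => hW.limDeriv_mono hs ht,
    fun s hs x => hW.limPoint_eq_of_lt hs, fun a b => hW.exists_limDeriv_lt⟩, ?_⟩
  · refine (hW.continuousOn_limDeriv k).congr ?_
    rintro ⟨t, x⟩ ⟨ht, -⟩
    simp only [hW.iteratedDeriv_limDeriv ht]
  · have h0 := hW.limDeriv_zero_eq 0 (Nat.zero_le (K 0))
    have h1 := hW.limDeriv_zero_eq 0 (hW.adic.zero.symm.le)
    have h2 := hW.limPoint_eq 0 (Nat.zero_le (K 0))
    have h3 := hW.limPoint_eq 0 (hW.adic.zero.symm.le)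
    rw [hW.adic.zero] at h0 h1 h2 h3
    simp only [Nat.cast_zero, Nat.cast_one, div_one] at h0 h1 h2 h3
    exact ⟨h0, h1, h2, h3⟩

lemma _root_.Function.Periodic.iteratedDeriv {f : ℝ → ℝ} {c : ℝ} (hf : Function.Periodic f c)
    (k : ℕ) : Function.Periodic (iteratedDeriv k f) c := by
  intro x
  have h : (fun z => f (z + c)) = f := funext hf
  have := congrFun (iteratedDeriv_comp_add_const k f c) x
  rw [h] at this
  exact this.symm

/-- Smooth bump, positive exactly on `(0, 4π)`, whose `2π`-translates sum to `1`. -/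
noncomputable def bump (x : ℝ) : ℝ :=
  Real.smoothTransition (x / (2 * Real.pi)) - Real.smoothTransition (x / (2 * Real.pi) - 1)

lemma bump_contDiff : ContDiff ℝ ∞ bump := by
  unfold bump
  exact (Real.smoothTransition.contDiff.comp (by fun_prop)).sub
    (Real.smoothTransition.contDiff.comp (by fun_prop))

lemma bump_pos {x : ℝ} (h0 : 0 < x) (h1 : x < 4 * Real.pi) : 0 < bump x := by
  have hpi := Real.two_pi_pos
  unfold bump
  have h2 : 0 < x / (2 * Real.pi) := by positivity
  have h3 : x / (2 * Real.pi) < 2 := by rw [div_lt_iff₀ hpi]; linarith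
  rw [sub_pos]
  rcases le_total (x / (2 * Real.pi)) 1 with h | h
  · rw [Real.smoothTransition.zero_of_nonpos (x := x / (2 * Real.pi) - 1) (by linarith)]
    exact Real.smoothTransition.pos_of_pos h2
  · rw [Real.smoothTransition.one_of_one_le h]
    exact Real.smoothTransition.lt_one_of_lt_one (by linarith)

lemma bump_eq_zero {x : ℝ} (h : ¬ (0 < x ∧ x < 4 * Real.pi)) : bump x = 0 := by
  have hpi := Real.two_pi_pos
  unfold bump
  rcases le_or_gt x 0 with h0 | h0
  · have : x / (2 * Real.pi) ≤ 0 := div_nonpos_of_nonpos_of_nonneg h0 hpi.le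
    rw [Real.smoothTransition.zero_of_nonpos this,
      Real.smoothTransition.zero_of_nonpos (by linarith), sub_zero]
  · have h1 : 4 * Real.pi ≤ x := not_lt.1 fun h1 => h ⟨h0, h1⟩
    have : 2 ≤ x / (2 * Real.pi) := by rw [le_div_iff₀ hpi]; linarith
    rw [Real.smoothTransition.one_of_one_le (by linarith),
      Real.smoothTransition.one_of_one_le (by linarith), sub_self]

lemma bump_nonneg (x : ℝ) : 0 ≤ bump x := by
  by_cases h : 0 < x ∧ x < 4 * Real.pi
  · exact (bump_pos h.1 h.2).le
  · exact (bump_eq_zero h).ge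

lemma sum_bump {x : ℝ} (hx : |x| < 2 * Real.pi) :
    ∑ j ∈ Finset.range 3, bump (x + j * (2 * Real.pi)) = 1 := by
  have hpi := Real.two_pi_pos
  rw [abs_lt] at hx
  have h1 : -1 < x / (2 * Real.pi) := by rw [lt_div_iff₀ hpi]; linarith
  have h2 : x / (2 * Real.pi) < 1 := by rw [div_lt_iff₀ hpi]; linarith
  have h : ∀ j : ℝ, (x + j * (2 * Real.pi)) / (2 * Real.pi) = x / (2 * Real.pi) + j := by
    intro j; field_simp
  simp only [Finset.sum_range_succ, Finset.sum_range_zero, bump, h]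
  push_cast
  rw [Real.smoothTransition.zero_of_nonpos (x := x / (2 * Real.pi) + 0 - 1) (by linarith),
    Real.smoothTransition.one_of_one_le (x := x / (2 * Real.pi) + 2) (by linarith)]
  ring_nf

/-- The walk oscillating between `0` and `4π`. -/
noncomputable def baseWalk : Walk where
  S j x := j * bump x
  p j := if Even j then 0 else 4 * Real.pi
  smooth j := contDiff_const.mul bump_contDiff
  le_succ j x := by push_cast; nlinarith [bump_nonneg x]
  lt_succ_iff j x := by
    have hpi := Real.pi_pos
    have h1 : (j : ℝ) * bump x < ((j + 1 : ℕ) : ℝ) * bump x ↔ 0 < bump x := by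
      push_cast; constructor <;> intro h <;> linarith
    have h2 : 0 < bump x ↔ 0 < x ∧ x < 4 * Real.pi := by
      constructor
      · intro h
        by_contra h'
        exact h.ne' (bump_eq_zero h')
      · rintro ⟨h, h'⟩; exact bump_pos h h'
    rw [h1, h2]
    by_cases hj : Even j
    · simp only [hj, Nat.even_add_one, not_true_eq_false, if_true, if_false]
      exact (sub_mul_sub_neg_iff x 0 (4 * Real.pi) (by positivity)).symm
    · simp only [hj, Nat.even_add_one, not_false_eq_true, if_true, if_false]
      rw [mul_comm (x - 4 * Real.pi)]
      exact (sub_mul_sub_neg_iff x 0 (4 * Real.pi) (by positivity)).symm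
  ne_succ j := by
    have hpi := Real.pi_pos.ne'
    by_cases hj : Even j <;> simp [hj, Nat.even_add_one]

/-- Sum of all `2π`-translates of `g`. -/
noncomputable def periodize (g : ℝ → ℝ) (x : ℝ) : ℝ := ∑' k : ℤ, g (x + k * (2 * Real.pi))

lemma periodize_periodic (g : ℝ → ℝ) : Function.Periodic (periodize g) (2 * Real.pi) := by
  intro x
  unfold periodize
  rw [← (Equiv.addRight (1 : ℤ)).tsum_eq (fun k : ℤ => g (x + k * (2 * Real.pi)))]
  refine tsum_congr fun k => ?_
  simp only [Equiv.coe_addRight]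
  push_cast
  ring_nf

lemma periodize_eq_sum {g : ℝ → ℝ} (hg : ∀ x, ¬ (0 < x ∧ x < 4 * Real.pi) → g x = 0) (m : ℤ)
    {x : ℝ} (hx : |x - m * (2 * Real.pi)| < 2 * Real.pi) :
    periodize g x = ∑ j ∈ Finset.range 3, g (x - m * (2 * Real.pi) + j * (2 * Real.pi)) := by
  have hpi := Real.two_pi_pos
  rw [← (periodize_periodic g).sub_int_mul_eq m]
  set y := x - m * (2 * Real.pi)
  rw [abs_lt] at hx
  unfold periodize
  rw [tsum_eq_sum (s := (Finset.range 3).map Nat.castEmbedding), Finset.sum_map]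
  · simp
  · intro k hk
    apply hg
    rintro ⟨h1, h2⟩
    apply hk
    have h3 : (-1 : ℝ) < k := by
      by_contra! h
      nlinarith
    have h4 : (k : ℝ) < 3 := by
      by_contra! h
      nlinarith
    have h3' : -1 < k := by exact_mod_cast h3
    have h4' : k < 3 := by exact_mod_cast h4
    simp only [Finset.mem_map, Finset.mem_range, Nat.castEmbedding_apply]
    exact ⟨k.toNat, by omega, by simp; omega⟩

lemma isOpen_translate (m : ℤ) : IsOpen {x : ℝ | |x - m * (2 * Real.pi)| < 2 * Real.pi} :=
  isOpen_lt (by fun_prop) continuous_const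

lemma exists_translate (x : ℝ) : ∃ m : ℤ, |x - m * (2 * Real.pi)| < 2 * Real.pi := by
  have hpi := Real.two_pi_pos
  refine ⟨⌊x / (2 * Real.pi)⌋, ?_⟩
  have h1 := Int.floor_le (x / (2 * Real.pi))
  have h2 := Int.lt_floor_add_one (x / (2 * Real.pi))
  rw [le_div_iff₀ hpi] at h1
  rw [div_lt_iff₀ hpi] at h2
  rw [abs_lt]
  constructor <;> nlinarith

lemma iteratedDeriv_periodize_eq_sum {g : ℝ → ℝ} (hs : ContDiff ℝ ∞ g)
    (hg : ∀ x, ¬ (0 < x ∧ x < 4 * Real.pi) → g x = 0) (m : ℤ) (k : ℕ)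
    {x : ℝ} (hx : |x - m * (2 * Real.pi)| < 2 * Real.pi) :
    iteratedDeriv k (periodize g) x =
      ∑ j ∈ Finset.range 3, iteratedDeriv k g (x - m * (2 * Real.pi) + j * (2 * Real.pi)) := by
  have h : periodize g =ᶠ[𝓝 x] fun y =>
      ∑ j ∈ Finset.range 3, g (y + (j * (2 * Real.pi) - m * (2 * Real.pi))) := by
    filter_upwards [(isOpen_translate m).mem_nhds hx] with y hy
    rw [periodize_eq_sum hg m hy]
    exact Finset.sum_congr rfl fun j _ => by ring_nf
  rw [h.iteratedDeriv_eq, iteratedDeriv_fun_sum]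
  · refine Finset.sum_congr rfl fun j _ => ?_
    rw [iteratedDeriv_comp_add_const]
    ring_nf
  · intro j _
    exact (hs.comp (by fun_prop : ContDiff ℝ ∞ _)).contDiffAt_natCast k x

lemma periodize_contDiff {g : ℝ → ℝ} (hs : ContDiff ℝ ∞ g)
    (hg : ∀ x, ¬ (0 < x ∧ x < 4 * Real.pi) → g x = 0) : ContDiff ℝ ∞ (periodize g) := by
  rw [contDiff_iff_contDiffAt]
  intro x
  obtain ⟨m, hm⟩ := exists_translate x
  have h : periodize g =ᶠ[𝓝 x] fun y =>
      ∑ j ∈ Finset.range 3, g (y - m * (2 * Real.pi) + j * (2 * Real.pi)) := by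
    filter_upwards [(isOpen_translate m).mem_nhds hm] with y hy
    exact periodize_eq_sum hg m hy
  refine ContDiffAt.congr_of_eventuallyEq ?_ h
  refine ContDiff.contDiffAt (ContDiff.sum fun j _ => ?_)
  exact hs.comp (by fun_prop)

/-- A continuous path `ξ` on the circle, together with smooth functions `F u` on the circle that
increase with `u` and only grow at the current position of the path. -/
structure IsCircleFlow (F : ℝ → RealTorus → ℝ) (ξ : ℝ → RealTorus) : Prop where
  contDiff : ∀ u, ContDiff ℝ ∞ (fun x : ℝ => F u (x : RealTorus))
  continuous : ∀ k, Continuous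
    (fun q : ℝ × ℝ => iteratedDeriv k (fun y : ℝ => F q.1 (y : RealTorus)) q.2)
  path : Continuous ξ
  mono : ∀ x, Monotone fun u => F u x
  eq_of_lt : ∀ u x, (∀ r > u, F u x < F r x) → ξ u = x
  exists_lt : ∀ a b, a < b → ∃ x, F a x < F b x

/-- A circle flow progressing by one on each unit of time. -/
structure IsUnitCircleFlow (H : ℝ → RealTorus → ℝ) (ξ : ℝ → RealTorus) : Prop
    extends IsCircleFlow H ξ where
  path_nat : ∀ n : ℕ, ξ n = ((0 : ℝ) : RealTorus)
  apply_nat : ∀ (n : ℕ) x, H n x = n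
  bound : ∀ k, ∃ C, 0 ≤ C ∧ ∀ u, ∀ i ≤ k, ∀ x,
    |iteratedDeriv i (fun y : ℝ => H u (y : RealTorus) - u) x| ≤ C

/-- Deviation of the `k`-th derivative of `F u` from that of the constant `u`. -/
noncomputable def deviation (F : ℝ → ℝ → ℝ) (k : ℕ) (x u : ℝ) : ℝ :=
  iteratedDeriv k (F u) x - if k = 0 then u else 0

lemma exists_isUnitCircleFlow : ∃ H ξ, IsUnitCircleFlow H ξ := by
  obtain ⟨G, X, hG, hG0, hG1, hX0, hX1⟩ := exists_isLineFlow baseWalk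
  have hG0' : ∀ x, G 0 x = 0 := fun x => by rw [hG0]; simp [baseWalk]
  have hG1' : ∀ x, G 1 x = bump x := fun x => by rw [hG1]; simp [baseWalk]
  have h0m : (0 : ℝ) ∈ Icc (0 : ℝ) 1 := ⟨le_rfl, zero_le_one⟩
  have h1m : (1 : ℝ) ∈ Icc (0 : ℝ) 1 := ⟨zero_le_one, le_rfl⟩
  have hsupp : ∀ t ∈ Icc (0 : ℝ) 1, ∀ x, ¬ (0 < x ∧ x < 4 * Real.pi) → G t x = 0 := by
    intro t ht x hx
    have h1 := hG.mono 0 h0m t ht ht.1 x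
    have h2 := hG.mono t ht 1 h1m ht.2 x
    rw [hG0'] at h1
    rw [hG1', bump_eq_zero hx] at h2
    exact le_antisymm h2 h1
  set F : ℝ → ℝ → ℝ := fun t => periodize (G t) with hF
  have hFper : ∀ t, Function.Periodic (F t) (2 * Real.pi) := fun t => periodize_periodic _
  have hF0 : F 0 = fun _ => 0 := by
    ext x; simp [hF, periodize, hG0']
  have hF1 : F 1 = fun _ => 1 := by
    ext x
    obtain ⟨m, hm⟩ := exists_translate x
    simp only [hF]
    rw [periodize_eq_sum (hsupp 1 h1m) m hm]
    simp only [hG1']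
    exact sum_bump hm
  have hFmono : ∀ s ∈ Icc (0 : ℝ) 1, ∀ t ∈ Icc (0 : ℝ) 1, s ≤ t → ∀ x, F s x ≤ F t x := by
    intro s hs t ht hst x
    obtain ⟨m, hm⟩ := exists_translate x
    simp only [hF]
    rw [periodize_eq_sum (hsupp s hs) m hm, periodize_eq_sum (hsupp t ht) m hm]
    exact Finset.sum_le_sum fun j _ => hG.mono s hs t ht hst _
  have hFcont : ∀ k, ContinuousOn (fun q : ℝ × ℝ => iteratedDeriv k (F q.2) q.1)
      (univ ×ˢ Icc 0 1) := by
    rintro k ⟨x, t⟩ ⟨-, ht⟩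
    obtain ⟨m, hm⟩ := exists_translate x
    have hc : ContinuousOn (fun q : ℝ × ℝ => ∑ j ∈ Finset.range 3,
        iteratedDeriv k (G q.2) (q.1 - m * (2 * Real.pi) + j * (2 * Real.pi)))
        (univ ×ˢ Icc 0 1) := by
      refine continuousOn_finsetSum _ fun j _ => ?_
      exact (hG.continuousOn k).comp
        (f := fun q : ℝ × ℝ => (q.2, q.1 - m * (2 * Real.pi) + j * (2 * Real.pi)))
        (by fun_prop) (fun q hq => ⟨hq.2, mem_univ _⟩)
    refine (hc (x, t) ⟨mem_univ _, ht⟩).congr_of_eventuallyEq ?_ ?_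
    · have : {q : ℝ × ℝ | |q.1 - m * (2 * Real.pi)| < 2 * Real.pi} ∈ 𝓝 (x, t) :=
        ((isOpen_translate m).preimage continuous_fst).mem_nhds hm
      filter_upwards [mem_nhdsWithin_of_mem_nhds this, self_mem_nhdsWithin] with q hq hq'
      exact iteratedDeriv_periodize_eq_sum (hG.contDiff _ hq'.2) (hsupp _ hq'.2) m k hq
    · exact iteratedDeriv_periodize_eq_sum (hG.contDiff _ ht) (hsupp _ ht) m k hm
  have hEcont : ∀ k, ContinuousOn (Function.uncurry (deviation F k)) (univ ×ˢ Icc 0 1) := by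
    intro k
    refine (hFcont k).sub ?_
    split_ifs <;> fun_prop
  have hE01 : ∀ k x, deviation F k x 0 = deviation F k x 1 := by
    intro k x
    unfold deviation
    rw [hF0, hF1, iteratedDeriv_const, iteratedDeriv_const]
    split_ifs <;> simp
  have hfr : ∀ u : ℝ, Int.fract u ∈ Icc (0 : ℝ) 1 :=
    fun u => ⟨Int.fract_nonneg u, (Int.fract_lt_one u).le⟩
  have hHper : ∀ u : ℝ, Function.Periodic (fun x => ⌊u⌋ + F (Int.fract u) x) (2 * Real.pi) :=
    fun u x => by simp only [hFper (Int.fract u) x]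
  let H : ℝ → RealTorus → ℝ := fun u => (hHper u).lift
  have hH : ∀ u (x : ℝ), H u (x : RealTorus) = ⌊u⌋ + F (Int.fract u) x :=
    fun u x => (hHper u).lift_coe x
  have hFs : ∀ t ∈ Icc (0 : ℝ) 1, ContDiff ℝ ∞ (F t) := fun t ht =>
    periodize_contDiff (hG.contDiff t ht) (hsupp t ht)
  have hHdev : ∀ u k (x : ℝ), iteratedDeriv k (fun y : ℝ => H u (y : RealTorus) - u) x =
      deviation F k x (Int.fract u) := by
    intro u k x
    have : (fun y : ℝ => H u (y : RealTorus) - u) = fun y =>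
        F (Int.fract u) y - Int.fract u := by
      ext y; rw [hH]; have := Int.floor_add_fract u; linarith
    rw [this, iteratedDeriv_fun_sub ((hFs _ (hfr u)).contDiffAt_natCast k x)
      contDiffAt_const, iteratedDeriv_const, deviation]
  have hHs : ∀ u, ContDiff ℝ ∞ (fun x : ℝ => H u (x : RealTorus)) := by
    intro u
    simp only [hH]
    exact contDiff_const.add (hFs _ (hfr u))
  have hcell : ∀ (m : ℤ) (g : ℝ), 0 ≤ g → g ≤ 1 → ∀ x : ℝ,
      H (m + g) (x : RealTorus) = m + F g x := by
    intro m g h0 h1 x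
    rcases h1.lt_or_eq with h | rfl
    · rw [hH, Int.floor_intCast_add, Int.fract_intCast_add, Int.fract_eq_self.2 ⟨h0, h⟩,
        Int.floor_eq_zero_iff.2 ⟨h0, h⟩, add_zero]
    · rw [hH, Int.floor_intCast_add, Int.fract_intCast_add, Int.fract_one, Int.floor_one, hF0, hF1]
      push_cast; ring
  have hmono : ∀ x, Monotone fun u => H u x := by
    intro x
    induction x using QuotientAddGroup.induction_on with | H x => ?_
    have hF01 : ∀ t ∈ Icc (0 : ℝ) 1, 0 ≤ F t x ∧ F t x ≤ 1 := by
      intro t ht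
      have h1 := hFmono 0 h0m t ht ht.1 x
      have h2 := hFmono t ht 1 h1m ht.2 x
      rw [hF0] at h1
      rw [hF1] at h2
      exact ⟨h1, h2⟩
    intro u v huv
    change H u (x : RealTorus) ≤ H v (x : RealTorus)
    rw [hH, hH]
    rcases (Int.floor_mono huv).eq_or_lt with h | h
    · rw [h]
      refine add_le_add_right (hFmono _ (hfr u) _ (hfr v) ?_ x) _
      have h1 := Int.floor_add_fract u
      have h2 := Int.floor_add_fract v
      rw [h] at h1
      linarith
    · have h1 := (hF01 _ (hfr u)).2
      have h2 := (hF01 _ (hfr v)).1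
      have h3 : ((⌊u⌋ + 1 : ℤ) : ℝ) ≤ (⌊v⌋ : ℤ) := by exact_mod_cast h
      push_cast at h3
      linarith
  let ξ : ℝ → RealTorus := (fun t => ((X t : ℝ) : RealTorus)) ∘ Int.fract
  have hX01 : ((X 0 : ℝ) : RealTorus) = ((X 1 : ℝ) : RealTorus) := by
    have h0 : X 0 = 0 := by rw [hX0]; simp [baseWalk]
    have h1 : X 1 = 4 * Real.pi := by rw [hX1]; simp [baseWalk]
    rw [h0, h1]
    exact (AddCircle.coe_eq_zero_iff _).2 ⟨2, by simp; ring⟩ |>.symm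
  refine ⟨H, ξ, ⟨hHs, ?_, ?_, hmono, ?_, ?_⟩, ?_, ?_, ?_⟩
  · intro k
    have hc := (hEcont k).comp_fract' (hE01 k)
    have : (fun q : ℝ × ℝ => iteratedDeriv k (fun y : ℝ => H q.1 (y : RealTorus)) q.2) =
        fun q => deviation F k q.2 (Int.fract q.1) + if k = 0 then q.1 else 0 := by
      ext q
      rw [← hHdev, iteratedDeriv_fun_sub ((hHs _).contDiffAt_natCast k _) contDiffAt_const,
        iteratedDeriv_const, sub_add_cancel]
    rw [this]
    refine (hc.comp (continuous_snd.prodMk continuous_fst)).add ?_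
    split_ifs <;> fun_prop
  · refine ContinuousOn.comp_fract'' ?_ hX01
    exact (AddCircle.continuous_mk' _).comp_continuousOn hG.path
  · intro u x h
    induction x using QuotientAddGroup.induction_on with | H x => ?_
    obtain ⟨m, hm⟩ := exists_translate x
    have hs := hfr u
    have hs1 := Int.fract_lt_one u
    have hus : (⌊u⌋ : ℝ) + Int.fract u = u := Int.floor_add_fract u
    have hlt : ∀ r ∈ Ioc (Int.fract u) 1, F (Int.fract u) x < F r x := by
      intro r hr
      have h1 : H u (x : RealTorus) < H (⌊u⌋ + r) (x : RealTorus) := h _ (by linarith [hr.1])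
      rw [hcell _ r (hs.1.trans hr.1.le) hr.2, hH] at h1
      linarith
    obtain ⟨j, -, hj⟩ : ∃ j ∈ Finset.range 3, ∀ r ∈ Ioc (Int.fract u) 1,
        G (Int.fract u) (x - m * (2 * Real.pi) + j * (2 * Real.pi)) <
          G r (x - m * (2 * Real.pi) + j * (2 * Real.pi)) := by
      by_contra! hcon
      choose! r hr hr' using hcon
      have hrm : ∀ j ∈ Finset.range 3, r j ∈ Icc (0 : ℝ) 1 :=
        fun j hj => ⟨hs.1.trans (hr j hj).1.le, (hr j hj).2⟩
      obtain ⟨i, hi, hmin⟩ := Finset.exists_min_image (Finset.range 3) r ⟨0, by simp⟩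
      refine (hlt (r i) (hr i hi)).not_ge ?_
      simp only [hF]
      rw [periodize_eq_sum (hsupp _ (hrm i hi)) m hm, periodize_eq_sum (hsupp _ hs) m hm]
      exact Finset.sum_le_sum fun j hj =>
        (hG.mono _ (hrm i hi) _ (hrm j hj) (hmin j hj) _).trans (hr' j hj)
    change ((X (Int.fract u) : ℝ) : RealTorus) = x
    rw [hG.eq_of_lt _ ⟨hs.1, hs1⟩ _ hj]
    have hp : Function.Periodic (fun y : ℝ => (y : RealTorus)) (2 * Real.pi) :=
      AddCircle.coe_add_period _
    exact (hp.nat_mul j _).trans (hp.sub_int_mul_eq m)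
  · intro a b hab
    obtain ⟨g, hg, hg'⟩ : ∃ g, Int.fract a < g ∧ g < min 1 (b - ⌊a⌋) := by
      apply exists_between
      refine lt_min (Int.fract_lt_one a) ?_
      have := Int.floor_add_fract a
      linarith
    rw [lt_min_iff] at hg'
    have hgm : g ∈ Icc (0 : ℝ) 1 := ⟨(hfr a).1.trans hg.le, hg'.1.le⟩
    obtain ⟨x, hx⟩ := hG.exists_lt _ g (hfr a).1 hg hg'.1.le
    have hx0 : 0 < x ∧ x < 4 * Real.pi := by
      by_contra h
      rw [hsupp _ (hfr a) x h, hsupp _ hgm x h] at hx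
      exact hx.false
    have hm : |x - 2 * Real.pi - (0 : ℤ) * (2 * Real.pi)| < 2 * Real.pi := by
      rw [abs_lt]; push_cast; constructor <;> linarith
    have hF : F (Int.fract a) (x - 2 * Real.pi) < F g (x - 2 * Real.pi) := by
      simp only [hF]
      rw [periodize_eq_sum (hsupp _ (hfr a)) 0 hm, periodize_eq_sum (hsupp _ hgm) 0 hm]
      refine Finset.sum_lt_sum (fun j _ => hG.mono _ (hfr a) _ hgm hg.le _)
        ⟨1, by simp, ?_⟩
      simpa using hx
    refine ⟨((x - 2 * Real.pi : ℝ) : RealTorus), lt_of_lt_of_le ?_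
      (hmono _ (show ⌊a⌋ + g ≤ b by linarith))⟩
    simp only
    rw [hcell _ g hgm.1 hgm.2, hH]
    linarith
  · intro n
    simp only [ξ, Function.comp, Int.fract_natCast, hX0]
    simp [baseWalk]
  · intro n x
    induction x using QuotientAddGroup.induction_on with | H x => ?_
    exact (hH n x).trans (by simp [hF0])
  · have hC : ∀ k, ∃ C, 0 ≤ C ∧ ∀ u x,
        |iteratedDeriv k (fun y : ℝ => H u (y : RealTorus) - u) x| ≤ C := by
      intro k
      obtain ⟨C, hC⟩ := ((isCompact_Icc (a := (0 : ℝ)) (b := 2 * Real.pi)).prod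
        (isCompact_Icc (a := (0 : ℝ)) (b := 1))).exists_bound_of_continuousOn
        ((hEcont k).mono (prod_mono_left (subset_univ _)))
      refine ⟨|C|, abs_nonneg _, fun u x => ?_⟩
      obtain ⟨y, hy, hxy⟩ := ((hFper (Int.fract u)).iteratedDeriv k).exists_mem_Ico₀
        Real.two_pi_pos x
      rw [hHdev, deviation, hxy]
      exact (hC (y, Int.fract u) ⟨⟨hy.1, hy.2.le⟩, hfr u⟩).trans (le_abs_self C)
    choose C hC0 hC using hC
    intro k
    refine ⟨∑ i ∈ Finset.range (k + 1), C i, Finset.sum_nonneg fun i _ => hC0 i, ?_⟩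
    intro u i hi x
    exact (hC i u x).trans (Finset.single_le_sum (fun j _ => hC0 j) (by simp; omega))


namespace IsCircleFlow

variable {F : ℝ → RealTorus → ℝ} {ξ : ℝ → RealTorus}

lemma rescale (h : IsCircleFlow F ξ) (a c : ℝ) {l e : ℝ} (hl : 0 < l) (he : 0 < e) :
    IsCircleFlow (fun t x => c + e * F (l * (t - a)) x) (fun t => ξ (l * (t - a))) where
  contDiff t := contDiff_const.add (contDiff_const.mul (h.contDiff _))
  continuous k := by
    have : (fun q : ℝ × ℝ =>
        iteratedDeriv k (fun y : ℝ => c + e * F (l * (q.1 - a)) (y : RealTorus)) q.2) =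
        fun q => (if k = 0 then c else 0) +
          e * iteratedDeriv k (fun y : ℝ => F (l * (q.1 - a)) (y : RealTorus)) q.2 := by
      ext q
      have hs := (h.contDiff (l * (q.1 - a))).contDiffAt_natCast k q.2
      rw [iteratedDeriv_fun_add contDiffAt_const (contDiffAt_const.mul hs), iteratedDeriv_const,
        iteratedDeriv_const_mul_field]
    rw [this]
    exact continuous_const.add (continuous_const.mul ((h.continuous k).comp
      (f := fun q : ℝ × ℝ => (l * (q.1 - a), q.2)) (by fun_prop)))
  path := h.path.comp (by fun_prop)
  mono x s t hst := by
    have : F (l * (s - a)) x ≤ F (l * (t - a)) x := h.mono x (by gcongr)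
    simp only
    gcongr
  eq_of_lt t x ht := by
    refine h.eq_of_lt _ _ fun r hr => ?_
    have h1 := ht (a + r / l) (by
      rw [gt_iff_lt, ← sub_lt_iff_lt_add', lt_div_iff₀ hl, mul_comm]
      exact hr)
    rw [add_sub_cancel_left, mul_div_cancel₀ _ hl.ne'] at h1
    exact lt_of_mul_lt_mul_left (lt_of_add_lt_add_left h1) he.le
  exists_lt s t hst := by
    obtain ⟨x, hx⟩ := h.exists_lt (l * (s - a)) (l * (t - a)) (by gcongr)
    exact ⟨x, by gcongr⟩

lemma continuous_uncurry (h : IsCircleFlow F ξ) :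
    Continuous (fun q : ℝ × RealTorus => F q.1 q.2) := by
  have hq : Topology.IsQuotientMap
      (Prod.map id ((↑) : ℝ → RealTorus) : ℝ × ℝ → ℝ × RealTorus) :=
    (IsOpenQuotientMap.id.prodMap QuotientAddGroup.isOpenQuotientMap_mk).isQuotientMap
  rw [hq.continuous_iff]
  have := h.continuous 0
  simp only [iteratedDeriv_zero] at this
  exact this

lemma continuous_apply (h : IsCircleFlow F ξ) (x : RealTorus) : Continuous fun u => F u x :=
  h.continuous_uncurry.comp (by fun_prop : Continuous fun u : ℝ => (u, x))

lemma continuous_curve (h : IsCircleFlow F ξ) : Continuous fun u => (ξ u, F u (ξ u)) :=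
  h.path.prodMk (h.continuous_uncurry.comp (continuous_id.prodMk h.path))

lemma exists_path_eq (h : IsCircleFlow F ξ) {a b : ℝ} (hab : a ≤ b) {x : RealTorus} {y : ℝ}
    (h1 : F a x ≤ y) (h2 : y < F b x) : ∃ u ∈ Ico a b, ξ u = x ∧ F u x = y := by
  have hc := h.continuous_apply x
  have hA : IsCompact (Icc a b ∩ {u | F u x ≤ y}) :=
    isCompact_Icc.inter_right (isClosed_le hc continuous_const)
  obtain ⟨u, ⟨hu, huy⟩, hmax⟩ := hA.exists_isGreatest ⟨a, ⟨le_rfl, hab⟩, h1⟩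
  have hlt : ∀ r > u, y < F r x := by
    intro r hr
    rcases le_total r b with hrb | hrb
    · by_contra! hle
      exact (hmax ⟨⟨hu.1.trans hr.le, hrb⟩, hle⟩).not_gt hr
    · exact h2.trans_le (h.mono x hrb)
  have heq : F u x = y := by
    refine le_antisymm huy (ge_of_tendsto
      ((hc.tendsto u).mono_left nhdsWithin_le_nhds : Tendsto _ (𝓝[>] u) _) ?_)
    filter_upwards [self_mem_nhdsWithin] with r hr using (hlt r hr).le
  refine ⟨u, ⟨hu.1, hu.2.lt_of_ne ?_⟩, h.eq_of_lt u x fun r hr => heq ▸ hlt r hr, heq⟩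
  rintro rfl
  exact huy.not_gt h2

lemma image_curve (h : IsCircleFlow F ξ) {a t c : ℝ} (ha : ∀ x, F a x = c) (hat : a < t) :
    (fun u => (ξ u, F u (ξ u))) '' Icc a t =
      closure (interior {p : RealTorus × ℝ | c ≤ p.2 ∧ p.2 ≤ F t p.1}) := by
  apply Subset.antisymm
  · have hU : IsOpen {p : RealTorus × ℝ | c < p.2 ∧ p.2 < F t p.1} :=
      (isOpen_lt continuous_const continuous_snd).inter (isOpen_lt continuous_snd
        (h.continuous_uncurry.comp (continuous_const.prodMk continuous_fst)))
    have hsub := interior_maximal (t := {p : RealTorus × ℝ | c < p.2 ∧ p.2 < F t p.1})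
      (s := {p : RealTorus × ℝ | c ≤ p.2 ∧ p.2 ≤ F t p.1})
      (fun p hp => ⟨hp.1.le, hp.2.le⟩) hU
    rw [← closure_Ico hat.ne]
    refine (image_closure_subset_closure_image h.continuous_curve).trans
      (closure_minimal ?_ isClosed_closure)
    rintro _ ⟨s, hs, rfl⟩
    refine closure_mono hsub (mem_closure_iff_nhds.2 fun V hV => ?_)
    obtain ⟨r, hr, hrV⟩ := (mem_nhdsGE_iff_exists_mem_Ioc_Ico_subset hs.2).1
      (mem_nhdsWithin_of_mem_nhds (h.continuous_curve.continuousAt hV))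
    obtain ⟨x, hx⟩ := h.exists_lt s r hr.1
    obtain ⟨y, hy1, hy2⟩ := exists_between hx
    obtain ⟨v, hv, hvx, hvy⟩ := h.exists_path_eq hr.1.le hy1.le hy2
    refine ⟨(x, y), ?_, ?_, hy2.trans_le (h.mono x hr.2)⟩
    · have : (ξ v, F v (ξ v)) ∈ V := hrV hv
      rwa [hvx, hvy] at this
    · exact (ha x ▸ h.mono x hs.1 : c ≤ F s x).trans_lt hy1
  · refine closure_minimal ?_ (isCompact_Icc.image h.continuous_curve).isClosed
    rintro ⟨x, y⟩ hp
    have hy := (interior_subset hp).1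
    have hev : ∀ᶠ z in 𝓝 y, (x, z) ∈ interior {p : RealTorus × ℝ | c ≤ p.2 ∧ p.2 ≤ F t p.1} :=
      (by fun_prop : Continuous fun z : ℝ => (x, z)).continuousAt.eventually
        (isOpen_interior.mem_nhds hp)
    obtain ⟨z, hz, hyz⟩ :=
      ((hev.filter_mono (nhdsWithin_le_nhds (s := Ioi y))).and self_mem_nhdsWithin).exists
    have hzt : z ≤ F t x := (interior_subset hz).2
    obtain ⟨u, hu, hux, huy⟩ := h.exists_path_eq hat.le ((ha x).trans_le hy)
      (lt_of_lt_of_le hyz hzt)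
    exact ⟨u, ⟨hu.1, hu.2.le⟩, by simp only [hux, huy]⟩

lemma periodic (u : ℝ) :
    Function.Periodic (fun x : ℝ => F u (x : RealTorus)) (2 * Real.pi) :=
  fun x => by simp only [AddCircle.coe_add_period]

lemma exists_delta (h : IsCircleFlow F ξ) (k : ℕ) (t : ℝ) {ε : ℝ} (hε : 0 < ε) :
    ∃ δ > 0, ∀ s, |s - t| < δ → ∀ i ≤ k, ∀ x : ℝ,
      |iteratedDeriv i (fun y : ℝ => F s (y : RealTorus) - F t (y : RealTorus)) x| < ε := by
  have key : ∀ i ∈ Finset.range (k + 1), ∀ᶠ s in 𝓝 t, ∀ x ∈ Icc 0 (2 * Real.pi),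
      |iteratedDeriv i (fun y : ℝ => F s (y : RealTorus) - F t (y : RealTorus)) x| < ε := by
    intro i _
    refine isCompact_Icc.eventually_forall_of_forall_eventually fun x _ => ?_
    have hc : Continuous fun q : ℝ × ℝ =>
        |iteratedDeriv i (fun y : ℝ => F q.1 (y : RealTorus)) q.2 -
          iteratedDeriv i (fun y : ℝ => F t (y : RealTorus)) q.2| :=
      ((h.continuous i).sub ((h.continuous i).comp (f := fun q : ℝ × ℝ => (t, q.2))
        (by fun_prop))).abs
    have := hc.continuousAt.eventually_lt (continuousAt_const (y := ε)) (x₀ := (t, x)) (by simpa)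
    filter_upwards [this] with q hq
    rwa [iteratedDeriv_fun_sub ((h.contDiff _).contDiffAt_natCast i _)
      ((h.contDiff _).contDiffAt_natCast i _)]
  obtain ⟨δ, hδ, H⟩ := Metric.eventually_nhds_iff.1 ((Filter.eventually_all_finset _).2 key)
  refine ⟨δ, hδ, fun s hs i hi x => ?_⟩
  have hper : Function.Periodic (fun y : ℝ => F s (y : RealTorus) - F t (y : RealTorus))
      (2 * Real.pi) := (periodic s).sub (periodic t)
  obtain ⟨y, hy, hxy⟩ := (hper.iteratedDeriv i).exists_mem_Ico₀ Real.two_pi_pos x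
  rw [hxy]
  exact H (by rwa [Real.dist_eq]) i (by simp; omega) y ⟨hy.1, hy.2.le⟩

lemma differentiable (h : IsCircleFlow F ξ) (u : ℝ) :
    Differentiable ℝ fun x : ℝ => F u (x : RealTorus) :=
  (h.contDiff u).differentiable (by simp)

lemma deriv_eq (h : IsCircleFlow F ξ) {s t x : ℝ}
    (hx : F s (x : RealTorus) = F t (x : RealTorus)) :
    deriv (fun y : ℝ => F s (y : RealTorus)) x = deriv (fun y : ℝ => F t (y : RealTorus)) x := by
  wlog hst : s ≤ t generalizing s t
  · exact (this hx.symm (le_of_not_ge hst)).symm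
  have hmin : IsLocalMin (fun y : ℝ => F t (y : RealTorus) - F s (y : RealTorus)) x := by
    refine Filter.Eventually.of_forall fun y => ?_
    have := h.mono (y : RealTorus) hst
    simp only at this ⊢
    linarith
  have := hmin.deriv_eq_zero
  rw [deriv_fun_sub (h.differentiable t x) (h.differentiable s x)] at this
  linarith

lemma exists_slope (h : IsCircleFlow F ξ) {a b c d : ℝ} (hab : a ≤ b) (ha : ∀ x, F a x = c)
    (hb : ∀ x, F b x = d) : ∃ ψ : RealTorus × ℝ → ℝ, ContinuousOn ψ (univ ×ˢ Icc c d) ∧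
      ∀ t ∈ Icc a b, ∀ x : ℝ, deriv (fun y : ℝ => F t (y : RealTorus)) x =
        ψ ((x : RealTorus), F t (x : RealTorus)) := by
  let Φ : Icc a b × Icc 0 (2 * Real.pi) → RealTorus × ℝ :=
    fun z => (((z.2 : ℝ) : RealTorus), F z.1 ((z.2 : ℝ) : RealTorus))
  let D : Icc a b × Icc 0 (2 * Real.pi) → ℝ :=
    fun z => deriv (fun y : ℝ => F z.1 (y : RealTorus)) z.2
  have hcoe : Continuous fun z : Icc a b × Icc 0 (2 * Real.pi) => ((z.2 : ℝ) : RealTorus) :=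
    (AddCircle.continuous_mk' _).comp (by fun_prop)
  have hΦ : Continuous Φ := hcoe.prodMk (h.continuous_uncurry.comp
    ((continuous_subtype_val.comp continuous_fst).prodMk hcoe))
  have hD : Continuous D := by
    have := h.continuous 1
    simp only [iteratedDeriv_one] at this
    exact this.comp (f := fun z : Icc a b × Icc 0 (2 * Real.pi) => ((z.1 : ℝ), (z.2 : ℝ)))
      (by fun_prop)
  have hderiv : ∀ t (x y : ℝ), (x : RealTorus) = y →
      deriv (fun z : ℝ => F t (z : RealTorus)) x = deriv (fun z : ℝ => F t (z : RealTorus)) y := by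
    intro t x y hxy
    have hper := (periodic (F := F) t).iteratedDeriv 1
    rw [iteratedDeriv_one] at hper
    rw [← hper.lift_coe x, hxy, hper.lift_coe]
  have hfac : Function.FactorsThrough D Φ := by
    rintro ⟨s, x⟩ ⟨t, y⟩ hst
    obtain ⟨hxy, hF⟩ := Prod.mk.inj hst
    exact (h.deriv_eq (hF.trans (by rw [← hxy]))).trans (hderiv t x y hxy)
  have hrange : ∀ x : ℝ, ∃ y : Icc 0 (2 * Real.pi), ((y : ℝ) : RealTorus) = x := by
    intro x
    have hp : Function.Periodic (fun y : ℝ => (y : RealTorus)) (2 * Real.pi) :=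
      AddCircle.coe_add_period _
    obtain ⟨y, hy, hxy⟩ := hp.exists_mem_Ico₀ Real.two_pi_pos x
    exact ⟨⟨y, hy.1, hy.2.le⟩, hxy.symm⟩
  refine ⟨Function.extend Φ D 0, ?_, ?_⟩
  · rw [continuousOn_iff_isClosed]
    refine fun C hC => ⟨Φ '' (D ⁻¹' C), hΦ.isClosedMap _ (hC.preimage hD), ?_⟩
    ext ⟨x, y⟩
    refine and_congr_left fun hxy => ?_
    constructor
    · intro hC
      induction x using QuotientAddGroup.induction_on with | H x => ?_
      obtain ⟨x', hx'⟩ := hrange x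
      obtain ⟨u, hu, huy⟩ := intermediate_value_Icc hab (h.continuous_apply x).continuousOn
        (by rw [ha, hb]; exact hxy.2)
      have : Φ (⟨u, hu⟩, x') = ((x : RealTorus), y) := by
        simp only [Φ, hx']
        exact Prod.ext rfl huy
      refine ⟨(⟨u, hu⟩, x'), ?_, this⟩
      change Function.extend Φ D 0 ((x : RealTorus), y) ∈ C at hC
      rwa [← this, hfac.extend_apply] at hC
    · rintro ⟨z, hz, hzx⟩
      rw [mem_preimage, ← hzx, hfac.extend_apply]
      exact hz
  · intro t ht x
    obtain ⟨x', hx'⟩ := hrange x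
    have := hfac.extend_apply 0 (⟨t, ht⟩, x')
    simp only [Φ, hx'] at this
    rw [hderiv t x x' hx'.symm, this]

end IsCircleFlow

end PeanoWalk

/-- **Cylindrical version with controlled norms.** Given intervals
`[t₀,t₁]` and `[c,d]`, `k₀ ∈ ℕ` and `δ₀ > 0`, there exist a continuous
`γ : [t₀,t₁] → 𝕋 × [c,d]`, a family `t ↦ F_t ∈ C^∞(𝕋)` continuous into the `C^∞`
topology (functions on `𝕋` are identified with `2π`-periodic functions on `ℝ`), and a
continuous `ψ : 𝕋 × [c,d] → ℝ`, satisfying: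
(i)    `F_{t₀} ≡ c`, `F_{t₁} ≡ d`;
(ii)   if `t ≤ s` then `F_t ≤ F_s` pointwise;
(iii)  writing `γ(t) = (x(t), y(t))`, `y(t) = F_t(x(t))`;
(iv)   `F_t′(x) = ψ(x, F_t(x))` for all `t`, `x`;
(v)    for each `t ∈ (t₀,t₁]`, `γ([t₀,t])` equals the closure of the interior
       (in `𝕋 × ℝ`) of `{(x,y) : x ∈ 𝕋, c ≤ y ≤ F_t(x)}`;
(vi)   `γ(t₀) = (0, c)` and `γ(t₁) = (0, d)`;
(vii)  for every `t ∈ [t₀,t₁]`, `‖F_t − c_t‖_{k₀} < δ₀`, where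
       `c_t = (c(t₁ − t) + d(t − t₀))/(t₁ − t₀)`. -/
theorem exists_peano_curve_filling_cylinder_with_norm_control (t₀ t₁ c d : ℝ)
    (ht : t₀ < t₁) (hcd : c < d) (k₀ : ℕ) (δ₀ : ℝ) (hδ₀ : 0 < δ₀) :
    ∃ (γ : ℝ → RealTorus × ℝ) (F : ℝ → RealTorus → ℝ) (ψ : RealTorus × ℝ → ℝ),
      ContinuousOn γ (Icc t₀ t₁) ∧
      (∀ t ∈ Icc t₀ t₁, (γ t).2 ∈ Icc c d) ∧
      (∀ t ∈ Icc t₀ t₁, ContDiff ℝ (⊤ : ℕ∞) (fun x : ℝ => F t (x : RealTorus))) ∧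
      (∀ (k : ℕ), ∀ t ∈ Icc t₀ t₁, ∀ ε > (0:ℝ), ∃ δ > (0:ℝ),
        ∀ s ∈ Icc t₀ t₁, |s - t| < δ → ∀ i ≤ k, ∀ x : ℝ,
          |iteratedDeriv i
            (fun y : ℝ => F s (y : RealTorus) - F t (y : RealTorus)) x| < ε) ∧
      ContinuousOn ψ (univ ×ˢ Icc c d) ∧
      (∀ x : RealTorus, F t₀ x = c) ∧ (∀ x : RealTorus, F t₁ x = d) ∧
      (∀ t ∈ Icc t₀ t₁, ∀ s ∈ Icc t₀ t₁, t ≤ s → ∀ x : RealTorus, F t x ≤ F s x) ∧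
      (∀ t ∈ Icc t₀ t₁, (γ t).2 = F t (γ t).1) ∧
      (∀ t ∈ Icc t₀ t₁, ∀ x : ℝ,
        deriv (fun y : ℝ => F t (y : RealTorus)) x = ψ ((x : RealTorus), F t (x : RealTorus))) ∧
      (∀ t ∈ Ioc t₀ t₁, γ '' Icc t₀ t =
        closure (interior {p : RealTorus × ℝ | c ≤ p.2 ∧ p.2 ≤ F t p.1})) ∧
      γ t₀ = (((0 : ℝ) : RealTorus), c) ∧ γ t₁ = (((0 : ℝ) : RealTorus), d) ∧
      (∀ t ∈ Icc t₀ t₁, ∀ i ≤ k₀, ∀ x : ℝ,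
        |iteratedDeriv i
          (fun y : ℝ => F t (y : RealTorus) -
            (c * (t₁ - t) + d * (t - t₀)) / (t₁ - t₀)) x| < δ₀) := by
  obtain ⟨H, ξ, hH⟩ := PeanoWalk.exists_isUnitCircleFlow
  obtain ⟨C, hC0, hC⟩ := hH.bound k₀
  have hdc : 0 < d - c := sub_pos.2 hcd
  have htt : 0 < t₁ - t₀ := sub_pos.2 ht
  obtain ⟨n, hn⟩ := exists_nat_gt ((d - c) * C / δ₀)
  have hn0 : (0 : ℝ) < n := lt_of_le_of_lt (by positivity) hn
  set l : ℝ := n / (t₁ - t₀) with hl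
  set e : ℝ := (d - c) / n with he
  have he0 : 0 < e := by positivity
  have hF := hH.toIsCircleFlow.rescale t₀ c (l := l) (e := e) (by positivity) he0
  set F : ℝ → RealTorus → ℝ := fun t x => c + e * H (l * (t - t₀)) x
  have hl0 : l * (t₀ - t₀) = (0 : ℕ) := by simp
  have hl1 : l * (t₁ - t₀) = n := by rw [hl]; field_simp
  have hF0 : ∀ x, F t₀ x = c := by
    intro x
    change c + e * H (l * (t₀ - t₀)) x = c
    rw [hl0, hH.apply_nat]; simp
  have hF1 : ∀ x, F t₁ x = d := by
    intro x
    change c + e * H (l * (t₁ - t₀)) x = d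
    rw [hl1, hH.apply_nat, he]; field_simp; ring
  obtain ⟨ψ, hψ, hψF⟩ := hF.exists_slope ht.le hF0 hF1
  refine ⟨fun t => (ξ (l * (t - t₀)), F t (ξ (l * (t - t₀)))), F, ψ,
    hF.continuous_curve.continuousOn, fun t ht' => ⟨?_, ?_⟩, fun t _ => hF.contDiff t,
    fun k t _ ε hε => ?_, hψ, hF0, hF1, fun t _ s _ hts x => hF.mono x hts, fun _ _ => rfl,
    hψF, fun t ht' => hF.image_curve hF0 ht'.1, ?_, ?_, fun t _ i hi x => ?_⟩
  · exact (hF0 _).ge.trans (hF.mono _ ht'.1)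
  · exact (hF.mono _ ht'.2).trans (hF1 _).le
  · obtain ⟨δ, hδ, h⟩ := hF.exists_delta k t hε
    exact ⟨δ, hδ, fun s _ => h s⟩
  · simp only [hF0, hl0, hH.path_nat]
  · simp only [hF1, hl1, hH.path_nat]
  · have : (fun y : ℝ => F t (y : RealTorus) - (c * (t₁ - t) + d * (t - t₀)) / (t₁ - t₀)) =
        fun y : ℝ => e * (H (l * (t - t₀)) (y : RealTorus) - l * (t - t₀)) := by
      ext y
      change c + e * H (l * (t - t₀)) (y : RealTorus) - _ = _
      have : (c * (t₁ - t) + d * (t - t₀)) / (t₁ - t₀) = c + e * (l * (t - t₀)) := by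
        rw [he, hl]; field_simp; ring
      rw [this]; ring
    rw [this, iteratedDeriv_const_mul_field, abs_mul, abs_of_pos he0]
    refine (mul_le_mul_of_nonneg_left (hC _ i hi x) he0.le).trans_lt ?_
    rw [div_lt_iff₀ hδ₀] at hn
    rw [he, div_mul_eq_mul_div, div_lt_iff₀ hn0]
    linarith
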